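/- arXiv:math/0204312 — 6 statements merged into one kernel-verified Lean document; each statement's English description precedes it below -/
import Mathlib

section
/- Let m, n ≥ 1 be integers and let f : ℝ → ℝ be a measurable nonnegative function such that the measure on complex m×(m+n) matrices with density A ↦ f(tr(A A†)) with respect to Lebesgue measure is a probability measure. Write A = (B, X), where B is the m×m matrix formed by the first m columns of A and X is the m×n matrix formed by the remaining n columns. Then the pushforward, under the (almost everywhere defined) map A ↦ B⁻¹X, of the probability measure with density A ↦ f(tr(A A†)) is the measure on complex m×n matrices with density Z ↦ C · (det(1ₘ + Z Z†))^(−(m+n)), where C = (∫ (det(1ₘ + Z Z†))^(−(m+n)) dZ)⁻¹. In particular, this pushforward distribution is independent of the choice of f. -/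
open MeasureTheory Matrix
open scoped ENNReal Real ComplexOrder

/-- Left multiplication by `B` as a real-linear map on `m × n` complex matrices. -/
noncomputable def mulLeftReal {m : ℕ} (n : ℕ) (B : Matrix (Fin m) (Fin m) ℂ) :
    (Fin m → Fin n → ℂ) →ₗ[ℝ] (Fin m → Fin n → ℂ) :=
  LinearMap.restrictScalars ℝ
    { toFun := fun X => of.symm (B * of X)
      map_add' := fun X Y => by
        rw [← of_add_of, Matrix.mul_add]; rfl
      map_smul' := fun c X => by
        rw [← smul_of, Matrix.mul_smul]; rfl : (Fin m → Fin n → ℂ) →ₗ[ℂ] (Fin m → Fin n → ℂ) }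

/-- Right multiplication by `Q` as a real-linear map on `m × n` complex matrices. -/
noncomputable def mulRightReal (m : ℕ) {n : ℕ} (Q : Matrix (Fin n) (Fin n) ℂ) :
    (Fin m → Fin n → ℂ) →ₗ[ℝ] (Fin m → Fin n → ℂ) :=
  LinearMap.restrictScalars ℝ
    (LinearMap.pi fun i => (Matrix.toLin' Qᵀ).comp (LinearMap.proj i) :
      (Fin m → Fin n → ℂ) →ₗ[ℂ] (Fin m → Fin n → ℂ))

lemma mulRightReal_apply (m : ℕ) {n : ℕ} (Q : Matrix (Fin n) (Fin n) ℂ) (X : Fin m → Fin n → ℂ) :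
    mulRightReal m Q X = of.symm ((of X : Matrix (Fin m) (Fin n) ℂ) * Q : Matrix (Fin m) (Fin n) ℂ) := by
  ext i j
  simp [mulRightReal, Matrix.mulVec, Matrix.mul_apply, dotProduct, mul_comm]

lemma mulLeftReal_apply {m : ℕ} (n : ℕ) (B : Matrix (Fin m) (Fin m) ℂ) (X : Fin m → Fin n → ℂ) :
    mulLeftReal n B X = of.symm (B * (of X : Matrix (Fin m) (Fin n) ℂ) : Matrix (Fin m) (Fin n) ℂ) := rfl

lemma det_mulRightReal (m : ℕ) {n : ℕ} (Q : Matrix (Fin n) (Fin n) ℂ) :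
    LinearMap.det (mulRightReal m Q) = Complex.normSq Q.det ^ m := by
  rw [mulRightReal, LinearMap.det_restrictScalars, LinearMap.det_pi, Algebra.norm_complex_apply]
  simp

lemma det_mulLeftReal {m : ℕ} (n : ℕ) (B : Matrix (Fin m) (Fin m) ℂ) :
    LinearMap.det (mulLeftReal n B) = Complex.normSq B.det ^ n := by
  rw [← Matrix.det_transpose B, ← det_mulRightReal n Bᵀ]
  rw [← LinearMap.det_conj (mulLeftReal n B)
    (Matrix.transposeLinearEquiv (Fin m) (Fin n) ℝ ℂ : (Fin m → Fin n → ℂ) ≃ₗ[ℝ] (Fin n → Fin m → ℂ))]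
  congr 1

instance isAddHaarMeasure_volume_pi_pi (m n : ℕ) :
    (volume : Measure (Fin m → Fin n → ℂ)).IsAddHaarMeasure :=
  Measure.pi.isAddHaarMeasure fun _ : Fin m => (volume : Measure (Fin n → ℂ))

lemma lintegral_comp_linearMap_mul {E : Type*} [NormedAddCommGroup E] [NormedSpace ℝ E]
    [MeasurableSpace E] [BorelSpace E] [FiniteDimensional ℝ E] (μ : Measure E)
    [μ.IsAddHaarMeasure] {L : E →ₗ[ℝ] E} (hL : LinearMap.det L ≠ 0) {k : E → ℝ≥0∞}
    (hk : Measurable k) :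
    ∫⁻ x, k (L x) ∂μ = ENNReal.ofReal |(LinearMap.det L)⁻¹| * ∫⁻ x, k x ∂μ := by
  rw [← lintegral_map hk L.continuous_of_finiteDimensional.measurable,
    Measure.map_linearMap_addHaar_eq_smul_addHaar μ hL, lintegral_smul_measure, smul_eq_mul]

lemma lintegral_comp_mulRight (m : ℕ) {n : ℕ} {Q : Matrix (Fin n) (Fin n) ℂ} (hQ : Q.det ≠ 0)
    {k : (Fin m → Fin n → ℂ) → ℝ≥0∞} (hk : Measurable k) :
    ∫⁻ X, k (of.symm ((of X : Matrix (Fin m) (Fin n) ℂ) * Q : Matrix (Fin m) (Fin n) ℂ)) =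
      ENNReal.ofReal (Complex.normSq Q.det ^ m)⁻¹ * ∫⁻ X, k X := by
  have h0 : 0 < Complex.normSq Q.det ^ m := pow_pos (Complex.normSq_pos.2 hQ) m
  have := lintegral_comp_linearMap_mul (volume : Measure (Fin m → Fin n → ℂ))
    (L := mulRightReal m Q) (by rw [det_mulRightReal]; exact h0.ne') hk
  simpa only [mulRightReal_apply, det_mulRightReal, abs_of_pos (inv_pos.2 h0)] using this

lemma lintegral_eq_mulLeft {m : ℕ} (n : ℕ) {B : Matrix (Fin m) (Fin m) ℂ} (hB : B.det ≠ 0)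
    {k : (Fin m → Fin n → ℂ) → ℝ≥0∞} (hk : Measurable k) :
    ∫⁻ X, k X = ENNReal.ofReal (Complex.normSq B.det ^ n) *
      ∫⁻ X, k (of.symm (B * (of X : Matrix (Fin m) (Fin n) ℂ) : Matrix (Fin m) (Fin n) ℂ)) := by
  have h0 : 0 < Complex.normSq B.det ^ n := pow_pos (Complex.normSq_pos.2 hB) n
  have := lintegral_comp_linearMap_mul (volume : Measure (Fin m → Fin n → ℂ))
    (L := mulLeftReal n B) (by rw [det_mulLeftReal]; exact h0.ne') hk
  simp only [mulLeftReal_apply, det_mulLeftReal, abs_of_pos (inv_pos.2 h0)] at this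
  rw [this, ← mul_assoc, ← ENNReal.ofReal_mul h0.le, mul_inv_cancel₀ h0.ne', ENNReal.ofReal_one,
    one_mul]

lemma measurable_det (m : ℕ) : Measurable fun B : Fin m → Fin m → ℂ => (of B).det := by
  have : Continuous fun B : Fin m → Fin m → ℂ => (of B).det :=
    Continuous.matrix_det continuous_id
  exact this.measurable

lemma ae_det_ne_zero (m : ℕ) : ∀ᵐ B : Fin m → Fin m → ℂ, (of B).det ≠ 0 := by
  set N : Set (Fin m → Fin m → ℂ) := {B | (of B).det = 0}
  have hN : MeasurableSet N := measurable_det m (measurableSet_singleton 0)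
  let s : ℝ → (Fin m → Fin m → ℂ) := fun t => of.symm (scalar (Fin m) (t : ℂ))
  have hs : Measurable s := by
    refine measurable_pi_lambda _ fun i => measurable_pi_lambda _ fun j => ?_
    by_cases h : i = j
    · subst h; simpa [s] using Complex.measurable_ofReal
    · simp [s, h]
  have hfin : ∀ B : Fin m → Fin m → ℂ, volume {t : ℝ | B + s t ∈ N} = 0 := by
    intro B
    have hfinite : {z : ℂ | (-of B).charpoly.IsRoot z}.Finite :=
      Polynomial.finite_setOfPred_isRoot (charpoly_monic _).ne_zero
    refine Set.Finite.measure_zero ?_ _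
    refine (hfinite.preimage (f := ((↑) : ℝ → ℂ)) Complex.ofReal_injective.injOn).subset ?_
    intro t ht
    simp only [Set.mem_preimage, Set.mem_ofPred_eq, Polynomial.IsRoot, eval_charpoly, sub_neg_eq_add,
      add_comm _ (of B)]
    exact ht
  have hms : MeasurableSet {p : (Fin m → Fin m → ℂ) × ℝ | p.1 + s p.2 ∈ N} :=
    (measurable_fst.add (hs.comp measurable_snd)) hN
  have h1 : ((volume : Measure (Fin m → Fin m → ℂ)).prod (volume : Measure ℝ))
      {p | p.1 + s p.2 ∈ N} = 0 := by
    rw [Measure.prod_apply hms]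
    simp [Set.preimage, hfin]
  rw [Measure.prod_apply_symm hms] at h1
  have h2 : ∀ t : ℝ, volume ((fun B : Fin m → Fin m → ℂ => (B, t)) ⁻¹' {p | p.1 + s p.2 ∈ N})
      = volume N := fun t => by
    exact (measurePreserving_add_right volume (s t)).measure_preimage hN.nullMeasurableSet
  simp only [h2, lintegral_const, Real.volume_univ] at h1
  rw [ae_iff]
  simpa using h1

open scoped MatrixOrder Matrix.Norms.L2Operator in
lemma Matrix.PosDef.exists_eq_mul_conjTranspose {m : ℕ} {M : Matrix (Fin m) (Fin m) ℂ}
    (hM : M.PosDef) : ∃ Q : Matrix (Fin m) (Fin m) ℂ, M = Q * Qᴴ := by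
  obtain ⟨P, hP⟩ := CStarAlgebra.nonneg_iff_eq_star_mul_self.mp hM.posSemidef.nonneg
  exact ⟨Pᴴ, by simpa [star_eq_conjTranspose] using hP⟩

lemma posDef_one_add_mul_conjTranspose {m n : ℕ} (Z : Matrix (Fin m) (Fin n) ℂ) :
    (1 + Z * Zᴴ).PosDef :=
  PosDef.one.add_posSemidef (posSemidef_self_mul_conjTranspose Z)

lemma measurePreserving_splitColumns (m n : ℕ) :
    MeasurePreserving (fun A : Fin m → Fin (m + n) → ℂ =>
      ((fun i j => A i (Fin.castAdd n j), fun i j => A i (Fin.natAdd m j)) :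
        (Fin m → Fin m → ℂ) × (Fin m → Fin n → ℂ))) volume volume := by
  have h1 : MeasurePreserving (MeasurableEquiv.piCongrLeft (fun _ : Fin (m + n) => ℂ)
      (finSumFinEquiv : Fin m ⊕ Fin n ≃ Fin (m + n))).symm volume volume :=
    (volume_measurePreserving_piCongrLeft _ _).symm
  have h2 := (volume_measurePreserving_sumPiEquivProdPi fun _ : Fin m ⊕ Fin n => ℂ).comp h1
  have : SigmaFinite (volume : Measure ((Fin m → ℂ) × (Fin n → ℂ))) :=
    inferInstanceAs (SigmaFinite ((volume : Measure (Fin m → ℂ)).prod volume))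
  have h3 := volume_preserving_pi (fun _ : Fin m => h2)
  exact (volume_measurePreserving_arrowProdEquivProdArrow (Fin m → ℂ) (Fin n → ℂ) (Fin m)).comp h3

lemma lintegral_splitColumns (m n : ℕ)
    {k : (Fin m → Fin m → ℂ) × (Fin m → Fin n → ℂ) → ℝ≥0∞} (hk : Measurable k) :
    ∫⁻ A : Fin m → Fin (m + n) → ℂ,
        k (fun i j => A i (Fin.castAdd n j), fun i j => A i (Fin.natAdd m j)) =
      ∫⁻ B : Fin m → Fin m → ℂ, ∫⁻ X : Fin m → Fin n → ℂ, k (B, X) := by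
  rw [(measurePreserving_splitColumns m n).lintegral_comp hk, Measure.volume_eq_prod,
    lintegral_prod _ hk.aemeasurable]

lemma mul_conjTranspose_splitColumns {m n : ℕ} (A : Fin m → Fin (m + n) → ℂ) :
    of A * (of A)ᴴ = (of fun i j => A i (Fin.castAdd n j)) * (of fun i j => A i (Fin.castAdd n j))ᴴ
      + (of fun i j => A i (Fin.natAdd m j)) * (of fun i j => A i (Fin.natAdd m j))ᴴ := by
  ext i j
  simp [Matrix.mul_apply, Fin.sum_univ_add]

/-- The weight of a square matrix `C` in the constant relating the two densities. -/
noncomputable def radialWeight (m n : ℕ) (f : ℝ → ℝ) (C : Fin m → Fin m → ℂ) : ℝ≥0∞ :=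
  ENNReal.ofReal (Complex.normSq (of C).det ^ n) *
    ENNReal.ofReal (f (Matrix.trace (of C * (of C)ᴴ)).re)

lemma measurable_trace_mul_conjTranspose (m n : ℕ) :
    Measurable fun A : Fin m → Fin n → ℂ => (Matrix.trace (of A * (of A)ᴴ)).re := by
  refine Continuous.measurable ?_
  simp only [Matrix.trace, Matrix.diag, Matrix.mul_apply, conjTranspose_apply, of_apply]
  fun_prop

lemma continuous_det_one_add (m n : ℕ) :
    Continuous fun Z : Fin m → Fin n → ℂ => ((1 + of Z * (of Z)ᴴ).det).re := by
  refine Complex.continuous_re.comp (Continuous.matrix_det ?_)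
  have : Continuous fun Z : Fin m → Fin n → ℂ => of Z := continuous_id
  fun_prop

lemma measurable_radialWeight (m n : ℕ) {f : ℝ → ℝ} (hf : Measurable f) :
    Measurable (radialWeight m n f) := by
  have h1 : Measurable fun C : Fin m → Fin m → ℂ => Complex.normSq (of C).det :=
    Complex.continuous_normSq.measurable.comp (measurable_det m)
  exact (h1.pow_const n).ennreal_ofReal.mul
    (hf.comp (measurable_trace_mul_conjTranspose m m)).ennreal_ofReal

lemma lintegral_radialWeight_fiber {m n : ℕ} {f : ℝ → ℝ} (hf : Measurable f)
    (Z : Fin m → Fin n → ℂ) :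
    ∫⁻ B : Fin m → Fin m → ℂ, ENNReal.ofReal (Complex.normSq (of B).det ^ n) *
        ENNReal.ofReal (f (Matrix.trace (of B * (1 + of Z * (of Z)ᴴ) * (of B)ᴴ)).re) =
      ENNReal.ofReal ((1 + of Z * (of Z)ᴴ).det.re ^ (-((m : ℝ) + n))) *
        ∫⁻ C, radialWeight m n f C := by
  obtain ⟨Q, hQ⟩ := (posDef_one_add_mul_conjTranspose (of Z)).exists_eq_mul_conjTranspose
  have hdet : (1 + of Z * (of Z)ᴴ).det = (Complex.normSq Q.det : ℂ) := by
    rw [hQ, det_mul, det_conjTranspose, Complex.normSq_eq_conj_mul_self, mul_comm]; rfl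
  have hQ0 : Q.det ≠ 0 := by
    intro h
    have := (posDef_one_add_mul_conjTranspose (of Z)).det_pos.ne'
    rw [hdet, h] at this
    simp at this
  have hpos : 0 < Complex.normSq Q.det := Complex.normSq_pos.2 hQ0
  have hw : ∀ B : Fin m → Fin m → ℂ, ENNReal.ofReal (Complex.normSq (of B).det ^ n) *
        ENNReal.ofReal (f (Matrix.trace (of B * (1 + of Z * (of Z)ᴴ) * (of B)ᴴ)).re) =
      ENNReal.ofReal (Complex.normSq Q.det ^ n)⁻¹ *
        radialWeight m n f (of.symm (of B * Q : Matrix (Fin m) (Fin m) ℂ)) := by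
    intro B
    rw [radialWeight, ← mul_assoc, ← ENNReal.ofReal_mul (inv_nonneg.2 (pow_nonneg hpos.le n)),
      Equiv.apply_symm_apply, det_mul, map_mul, mul_pow, hQ, conjTranspose_mul]
    congr 2
    · field_simp
    · simp only [Matrix.mul_assoc]
  simp_rw [hw]
  rw [lintegral_const_mul' _ _ ENNReal.ofReal_ne_top,
    lintegral_comp_mulRight m hQ0 (measurable_radialWeight m n hf), ← mul_assoc,
    ← ENNReal.ofReal_mul (inv_nonneg.2 (pow_nonneg hpos.le n)), hdet, Complex.ofReal_re,
    Real.rpow_neg hpos.le, ← Nat.cast_add, Real.rpow_natCast, pow_add, mul_inv, mul_comm (_⁻¹)]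

lemma measurable_matrix_det {α : Type*} [MeasurableSpace α] {m : ℕ}
    {B : α → Matrix (Fin m) (Fin m) ℂ} (hB : ∀ i j, Measurable fun a => B a i j) :
    Measurable fun a => (B a).det := by
  simp only [Matrix.det_apply']
  fun_prop

lemma measurable_inv_mul {α : Type*} [MeasurableSpace α] {m n : ℕ}
    {B : α → Matrix (Fin m) (Fin m) ℂ} {X : α → Matrix (Fin m) (Fin n) ℂ}
    (hB : ∀ i j, Measurable fun a => B a i j) (hX : ∀ i j, Measurable fun a => X a i j) :
    Measurable fun a => (of.symm ((B a)⁻¹ * X a) : Fin m → Fin n → ℂ) := by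
  have hadj : ∀ i j, Measurable fun a => (B a).adjugate i j := by
    intro i j
    simp only [adjugate_apply]
    refine measurable_matrix_det fun k l => ?_
    by_cases hk : k = j
    · subst hk
      simp
    · simpa [updateRow_ne hk] using hB k l
  refine measurable_pi_lambda _ fun i => measurable_pi_lambda _ fun j => ?_
  simp only [of_symm_apply, Matrix.mul_apply, Matrix.inv_def, Ring.inverse_eq_inv',
    Matrix.smul_apply, smul_eq_mul]
  exact Finset.measurable_sum _ fun l _ =>
    ((measurable_matrix_det hB).inv.mul (hadj i l)).mul (hX l j)

lemma lintegral_comp_inv_mul {m n : ℕ} {f : ℝ → ℝ} (hf : Measurable f)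
    {h : (Fin m → Fin n → ℂ) → ℝ≥0∞} (hh : Measurable h) :
    ∫⁻ A : Fin m → Fin (m + n) → ℂ, ENNReal.ofReal (f (Matrix.trace (of A * (of A)ᴴ)).re) *
        h (of.symm (((of A).submatrix id (Fin.castAdd n))⁻¹ *
          (of A).submatrix id (Fin.natAdd m) : Matrix (Fin m) (Fin n) ℂ)) =
      ∫⁻ Z : Fin m → Fin n → ℂ,
        (∫⁻ C, radialWeight m n f C) *
          ENNReal.ofReal ((1 + of Z * (of Z)ᴴ).det.re ^ (-((m : ℝ) + n))) * h Z := by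
  let k : (Fin m → Fin m → ℂ) × (Fin m → Fin n → ℂ) → ℝ≥0∞ := fun p =>
    ENNReal.ofReal (f ((Matrix.trace (of p.1 * (of p.1)ᴴ)).re +
      (Matrix.trace (of p.2 * (of p.2)ᴴ)).re)) *
      h (of.symm ((of p.1)⁻¹ * of p.2 : Matrix (Fin m) (Fin n) ℂ))
  have hk : Measurable k :=
    (hf.comp (((measurable_trace_mul_conjTranspose m m).comp measurable_fst).add
      ((measurable_trace_mul_conjTranspose m n).comp measurable_snd))).ennreal_ofReal.mul
      (hh.comp (measurable_inv_mul
        (B := fun p : (Fin m → Fin m → ℂ) × (Fin m → Fin n → ℂ) => of p.1)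
        (X := fun p => of p.2) (fun i j => by simp only [of_apply]; fun_prop)
        fun i j => by simp only [of_apply]; fun_prop))
  let g : (Fin m → Fin m → ℂ) → (Fin m → Fin n → ℂ) → ℝ≥0∞ := fun B Z =>
    ENNReal.ofReal (Complex.normSq (of B).det ^ n) *
      ENNReal.ofReal (f (Matrix.trace (of B * (1 + of Z * (of Z)ᴴ) * (of B)ᴴ)).re)
  have hg : Measurable (Function.uncurry g) := by
    have h1 : Continuous fun p : (Fin m → Fin m → ℂ) × (Fin m → Fin n → ℂ) =>
      (of p.1 : Matrix (Fin m) (Fin m) ℂ) := continuous_fst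
    have h2 : Continuous fun p : (Fin m → Fin m → ℂ) × (Fin m → Fin n → ℂ) =>
      (of p.2 : Matrix (Fin m) (Fin n) ℂ) := continuous_snd
    have h3 : Continuous fun p : (Fin m → Fin m → ℂ) × (Fin m → Fin n → ℂ) =>
        (Matrix.trace (of p.1 * (1 + of p.2 * (of p.2)ᴴ) * (of p.1)ᴴ)).re :=
      Complex.continuous_re.comp (Continuous.matrix_trace (by fun_prop))
    have h4 : Continuous fun p : (Fin m → Fin m → ℂ) × (Fin m → Fin n → ℂ) =>
        Complex.normSq (of p.1).det :=
      Complex.continuous_normSq.comp h1.matrix_det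
    exact (h4.measurable.pow_const n).ennreal_ofReal.mul (hf.comp h3.measurable).ennreal_ofReal
  calc _ = ∫⁻ A : Fin m → Fin (m + n) → ℂ,
        k (fun i j => A i (Fin.castAdd n j), fun i j => A i (Fin.natAdd m j)) := by
        refine lintegral_congr fun A => ?_
        rw [mul_conjTranspose_splitColumns, trace_add, Complex.add_re]
        rfl
    _ = ∫⁻ B : Fin m → Fin m → ℂ, ∫⁻ X : Fin m → Fin n → ℂ, k (B, X) :=
        lintegral_splitColumns m n hk
    _ = ∫⁻ B : Fin m → Fin m → ℂ, ∫⁻ Z : Fin m → Fin n → ℂ, g B Z * h Z := by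
        refine lintegral_congr_ae ?_
        filter_upwards [ae_det_ne_zero m] with B hB
        rw [lintegral_eq_mulLeft n hB (k := fun X => k (B, X)) (hk.comp measurable_prodMk_left),
          ← lintegral_const_mul' _ _ ENNReal.ofReal_ne_top]
        refine lintegral_congr fun Z => ?_
        simp only [k, g, Equiv.apply_symm_apply]
        rw [← Matrix.mul_assoc, nonsing_inv_mul _ (isUnit_iff_ne_zero.2 hB), Matrix.one_mul,
          Equiv.symm_apply_apply, mul_assoc, ← Complex.add_re, ← trace_add, conjTranspose_mul,
          Matrix.mul_add, Matrix.add_mul, Matrix.mul_one]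
        simp only [Matrix.mul_assoc]
    _ = ∫⁻ Z : Fin m → Fin n → ℂ, ∫⁻ B : Fin m → Fin m → ℂ, g B Z * h Z :=
        lintegral_lintegral_swap (hg.mul (hh.comp measurable_snd)).aemeasurable
    _ = _ := by
        refine lintegral_congr fun Z => ?_
        have hgZ : Measurable fun B => g B Z := hg.of_uncurry_right
        rw [lintegral_mul_const _ hgZ, lintegral_radialWeight_fiber hf Z, mul_comm (ENNReal.ofReal _)]

/-- **Universality of the distribution of `B⁻¹X` for complex random matrices.**
If `A = (B, X)` is an `m × (m+n)` complex random matrix with density `f(tr A A†)`,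
then `Z = B⁻¹X` has density `C · det(1 + Z Z†)^(−(m+n))` with
`C = (∫ det(1 + Z Z†)^(−(m+n)) dZ)⁻¹`, independently of `f`. -/
theorem universality_complex_Binv_X (m n : ℕ) (hm : 1 ≤ m) (hn : 1 ≤ n)
    (f : ℝ → ℝ) (hf_meas : Measurable f) (hf_nonneg : ∀ x, 0 ≤ f x)
    (μ : Measure (Fin m → Fin (m + n) → ℂ))
    (hμ : μ = volume.withDensity fun A =>
      ENNReal.ofReal (f (Matrix.trace (Matrix.of A * (Matrix.of A)ᴴ)).re))
    (hprob : IsProbabilityMeasure μ) :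
    μ.map (fun A : Fin m → Fin (m + n) → ℂ =>
        Matrix.of.symm
          (((Matrix.of A).submatrix id (Fin.castAdd n))⁻¹ *
            (Matrix.of A).submatrix id (Fin.natAdd m)))
      = volume.withDensity fun Z : Fin m → Fin n → ℂ =>
          (∫⁻ W : Fin m → Fin n → ℂ,
              ENNReal.ofReal
                ((Matrix.det (1 + Matrix.of W * (Matrix.of W)ᴴ)).re ^ (-((m : ℝ) + n))))⁻¹ *
            ENNReal.ofReal
              ((Matrix.det (1 + Matrix.of Z * (Matrix.of Z)ᴴ)).re ^ (-((m : ℝ) + n))) := by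
  have hD : Measurable fun Z : Fin m → Fin n → ℂ =>
      ENNReal.ofReal ((1 + of Z * (of Z)ᴴ).det.re ^ (-((m : ℝ) + n))) :=
    ((continuous_det_one_add m n).measurable.pow_const _).ennreal_ofReal
  have hφ : Measurable fun A : Fin m → Fin (m + n) → ℂ =>
      (of.symm (((of A).submatrix id (Fin.castAdd n))⁻¹ *
        (of A).submatrix id (Fin.natAdd m) : Matrix (Fin m) (Fin n) ℂ) : Fin m → Fin n → ℂ) :=
    measurable_inv_mul (fun i j => by simp only [submatrix_apply, of_apply]; fun_prop)
      fun i j => by simp only [submatrix_apply, of_apply]; fun_prop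
  have hmass : (∫⁻ C, radialWeight m n f C) * ∫⁻ Z : Fin m → Fin n → ℂ,
      ENNReal.ofReal ((1 + of Z * (of Z)ᴴ).det.re ^ (-((m : ℝ) + n))) = 1 := by
    have h1 := lintegral_comp_inv_mul (m := m) (n := n) hf_meas (h := fun _ => 1) measurable_const
    simp only [mul_one] at h1
    rw [← lintegral_const_mul _ hD, ← h1, ← setLIntegral_univ, ← withDensity_apply _ .univ, ← hμ]
    exact hprob.measure_univ
  rw [← ENNReal.eq_inv_of_mul_eq_one_left hmass]
  ext S hS
  rw [Measure.map_apply hφ hS, hμ, withDensity_apply _ (hφ hS), withDensity_apply _ hS,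
    ← lintegral_indicator (hφ hS), ← lintegral_indicator hS]
  have h1 := lintegral_comp_inv_mul (m := m) (n := n) hf_meas
    (h := S.indicator 1) (measurable_one.indicator hS)
  refine Eq.trans (lintegral_congr fun A => ?_) (h1.trans (lintegral_congr fun Z => ?_))
  · simp only [Set.indicator, Pi.one_apply, mul_ite, mul_one, mul_zero]
    rfl
  · by_cases hZ : Z ∈ S <;> simp [hZ]
end

section
/- Let m ≥ 1 and n ≥ 1 be integers, and let f : ℝ → ℝ be a measurable nonnegative function such that the measure on pairs (A, b), with A a real m×(m+n) matrix and b ∈ ℝ^m, with density (A, b) ↦ f(tr(Aᵀ A) + bᵀ b) with respect to Lebesgue measure, is a probability measure. Write A = (B, X), where B is the m×m matrix formed by the first m columns of A and X is the m×n matrix formed by the remaining n columns. Fix u ∈ ℝⁿ, and set β = √(1 + uᵀu). Then the pushforward, under the (almost everywhere defined) map (A, b) ↦ B⁻¹(b − Xu), of the probability measure with density (A, b) ↦ f(tr(Aᵀ A) + bᵀ b) is the measure on ℝ^m with density z ↦ (Γ((m+1)/2)/π^((m+1)/2)) · β · (β² + zᵀz)^(−(m+1)/2), independently of the choice of f. 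-/
open MeasureTheory Matrix
open scoped ENNReal Real

theorem lintegral_rpow_mul_exp_neg_mul_Ioi {a r : ℝ} (ha : 0 < a) (hr : 0 < r) :
    ∫⁻ t in Set.Ioi (0 : ℝ), ENNReal.ofReal (t ^ (a - 1) * Real.exp (-(r * t))) =
      ENNReal.ofReal (Real.Gamma a * r ^ (-a)) := by
  have hG := Real.Gamma_pos_of_pos ha
  have key := Real.integral_rpow_mul_exp_neg_mul_Ioi ha hr
  have hval : (1 / r) ^ a * Real.Gamma a = Real.Gamma a * r ^ (-a) := by
    rw [one_div, Real.inv_rpow hr.le, ← Real.rpow_neg hr.le, mul_comm]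
  rw [← ofReal_integral_eq_lintegral_ofReal, key, hval]
  · refine Integrable.of_integral_ne_zero ?_
    rw [key]
    positivity
  · filter_upwards [ae_restrict_mem measurableSet_Ioi] with t ht
    have : (0 : ℝ) < t := ht
    positivity

theorem lintegral_exp_neg_mul_sum_sq (m : ℕ) {t : ℝ} (ht : 0 < t) :
    ∫⁻ z : Fin m → ℝ, ENNReal.ofReal (Real.exp (-t * ∑ i, z i ^ 2)) =
      ENNReal.ofReal ((π / t) ^ ((m : ℝ) / 2)) := by
  have hprod (z : Fin m → ℝ) :
      Real.exp (-t * ∑ i, z i ^ 2) = ∏ i, Real.exp (-t * z i ^ 2) := by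
    rw [Finset.mul_sum, Real.exp_sum]
  simp_rw [hprod]
  rw [← ofReal_integral_eq_lintegral_ofReal]
  · rw [integral_fintype_prod_volume_eq_pow (fun x : ℝ => Real.exp (-t * x ^ 2)),
      integral_gaussian, Fintype.card_fin, Real.sqrt_eq_rpow, ← Real.rpow_natCast,
      ← Real.rpow_mul (by positivity)]
    congr 2
    ring
  · exact Integrable.fintype_prod fun _ => integrable_exp_neg_mul_sq ht
  · exact Filter.Eventually.of_forall fun z => by positivity

theorem lintegral_multivariate_cauchy (m : ℕ) {β : ℝ} (hβ : 0 < β) :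
    ∫⁻ z : Fin m → ℝ, ENNReal.ofReal
      (Real.Gamma ((m + 1 : ℝ) / 2) / Real.pi ^ ((m + 1 : ℝ) / 2) * β *
        (β ^ 2 + ∑ i, z i ^ 2) ^ (-((m : ℝ) + 1) / 2)) = 1 := by
  set a : ℝ := (m + 1 : ℝ) / 2 with ha_def
  have ha : 0 < a := by positivity
  have hpos (z : Fin m → ℝ) : 0 < β ^ 2 + ∑ i, z i ^ 2 := by positivity
  have hc : 0 ≤ β / π ^ a := by positivity
  calc
    _ = ∫⁻ z : Fin m → ℝ, ENNReal.ofReal (β / π ^ a) * ∫⁻ t in Set.Ioi (0 : ℝ),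
          ENNReal.ofReal (t ^ (a - 1) * Real.exp (-((β ^ 2 + ∑ i, z i ^ 2) * t))) := by
      refine lintegral_congr fun z => ?_
      rw [lintegral_rpow_mul_exp_neg_mul_Ioi ha (hpos z), ← ENNReal.ofReal_mul hc,
        show -((m : ℝ) + 1) / 2 = -a by rw [ha_def]; ring]
      congr 1
      ring
    _ = ENNReal.ofReal (β / π ^ a) * ∫⁻ t in Set.Ioi (0 : ℝ), ∫⁻ z : Fin m → ℝ,
          ENNReal.ofReal (t ^ (a - 1) * Real.exp (-((β ^ 2 + ∑ i, z i ^ 2) * t))) := by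
      rw [lintegral_const_mul' _ _ ENNReal.ofReal_ne_top, lintegral_lintegral_swap]
      exact Measurable.aemeasurable (by fun_prop)
    _ = ENNReal.ofReal (β / π ^ a) * ∫⁻ t in Set.Ioi (0 : ℝ),
          ENNReal.ofReal (π ^ ((m : ℝ) / 2)) *
            ENNReal.ofReal (t ^ ((1 / 2 : ℝ) - 1) * Real.exp (-(β ^ 2 * t))) := by
      congr 1
      refine setLIntegral_congr_fun measurableSet_Ioi fun t (ht : 0 < t) => ?_
      have hsplit (z : Fin m → ℝ) :
          t ^ (a - 1) * Real.exp (-((β ^ 2 + ∑ i, z i ^ 2) * t)) =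
            t ^ (a - 1) * Real.exp (-(β ^ 2 * t)) * Real.exp (-t * ∑ i, z i ^ 2) := by
        rw [mul_assoc, ← Real.exp_add]
        congr 2
        ring
      have hnn : 0 ≤ t ^ (a - 1) * Real.exp (-(β ^ 2 * t)) := by positivity
      simp_rw [hsplit, ENNReal.ofReal_mul hnn]
      rw [lintegral_const_mul' _ _ ENNReal.ofReal_ne_top, lintegral_exp_neg_mul_sum_sq m ht,
        ← ENNReal.ofReal_mul hnn, ← ENNReal.ofReal_mul (by positivity),
        Real.div_rpow Real.pi_pos.le ht.le,
        show (1 / 2 : ℝ) - 1 = (a - 1) - (m : ℝ) / 2 by rw [ha_def]; ring, Real.rpow_sub ht (a - 1)]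
      congr 1
      ring
    _ = 1 := by
      rw [lintegral_const_mul' _ _ ENNReal.ofReal_ne_top,
        lintegral_rpow_mul_exp_neg_mul_Ioi (by norm_num) (by positivity),
        ← ENNReal.ofReal_mul (by positivity), ← ENNReal.ofReal_mul hc,
        Real.Gamma_one_half_eq, Real.rpow_neg (by positivity), ← Real.sqrt_eq_rpow,
        Real.sqrt_sq hβ.le, ← ENNReal.ofReal_one]
      congr 1
      have : π ^ a = π ^ ((m : ℝ) / 2) * √π := by
        rw [Real.sqrt_eq_rpow, ← Real.rpow_add Real.pi_pos, ha_def]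
        congr 1
        ring
      rw [this]
      have h1 : 0 < √π := Real.sqrt_pos.2 Real.pi_pos
      have h2 : 0 < π ^ ((m : ℝ) / 2) := by positivity
      field_simp

/-- The symmetric square root of `(1 + y yᵀ)⁻¹`. -/
noncomputable def invSqrtOneAddVecMulVec {k : ℕ} (y : Fin k → ℝ) : Matrix (Fin k) (Fin k) ℝ :=
  1 + vecMulVec (-(1 / (√(1 + ∑ j, y j ^ 2) * (1 + √(1 + ∑ j, y j ^ 2)))) • y) y

theorem one_le_sqrt_one_add_sum_sq {k : ℕ} (y : Fin k → ℝ) : 1 ≤ √(1 + ∑ j, y j ^ 2) := by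
  rw [Real.one_le_sqrt]
  have : 0 ≤ ∑ j, y j ^ 2 := by positivity
  linarith

theorem invSqrtOneAddVecMulVec_mulVec {k : ℕ} (y v : Fin k → ℝ) (j : Fin k) :
    (invSqrtOneAddVecMulVec y *ᵥ v) j =
      v j - 1 / (√(1 + ∑ j, y j ^ 2) * (1 + √(1 + ∑ j, y j ^ 2))) * (∑ l, v l * y l) * y j := by
  rw [invSqrtOneAddVecMulVec, add_mulVec, one_mulVec, vecMulVec_mulVec]
  simp only [Pi.add_apply, Pi.smul_apply, MulOpposite.smul_eq_mul_unop, smul_eq_mul,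
    MulOpposite.unop_op, dotProduct, mul_comm (y _) (v _)]
  ring

theorem det_invSqrtOneAddVecMulVec {k : ℕ} (y : Fin k → ℝ) :
    (invSqrtOneAddVecMulVec y).det = (√(1 + ∑ j, y j ^ 2))⁻¹ := by
  rw [invSqrtOneAddVecMulVec, vecMulVec_eq Unit, det_one_add_replicateCol_mul_replicateRow,
    dotProduct_smul]
  have hγ := one_le_sqrt_one_add_sum_sq y
  have hsq : √(1 + ∑ j, y j ^ 2) ^ 2 = 1 + ∑ j, y j ^ 2 := Real.sq_sqrt (by positivity)
  set γ := √(1 + ∑ j, y j ^ 2)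
  have hd : y ⬝ᵥ y = γ ^ 2 - 1 := by
    simp only [dotProduct, ← pow_two]
    linarith
  rw [hd, smul_eq_mul]
  field_simp
  ring

theorem sum_sq_add_sq_invSqrtOneAddVecMulVec {k : ℕ} (y v : Fin k → ℝ) :
    ∑ j, (invSqrtOneAddVecMulVec y *ᵥ v) j ^ 2 +
      (∑ j, (invSqrtOneAddVecMulVec y *ᵥ v) j * y j) ^ 2 = ∑ j, v j ^ 2 := by
  simp only [invSqrtOneAddVecMulVec_mulVec]
  have hγ := one_le_sqrt_one_add_sum_sq y
  have hsq : √(1 + ∑ j, y j ^ 2) ^ 2 = 1 + ∑ j, y j ^ 2 := Real.sq_sqrt (by positivity)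
  set γ := √(1 + ∑ j, y j ^ 2)
  set d := ∑ j, v j * y j with hd
  have hs : ∑ j, y j ^ 2 = γ ^ 2 - 1 := by linarith
  have h1 (c : ℝ) : ∑ j, (v j - c * y j) ^ 2 =
      ∑ j, v j ^ 2 - 2 * c * d + c ^ 2 * (γ ^ 2 - 1) := by
    rw [← hs, hd, Finset.mul_sum, Finset.mul_sum, ← Finset.sum_sub_distrib,
      ← Finset.sum_add_distrib]
    exact Finset.sum_congr rfl fun j _ => by ring
  have h2 (c : ℝ) : ∑ j, (v j - c * y j) * y j = d - c * (γ ^ 2 - 1) := by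
    rw [← hs, hd, Finset.mul_sum, ← Finset.sum_sub_distrib]
    exact Finset.sum_congr rfl fun j _ => by ring
  rw [h1, h2]
  field_simp
  ring

theorem lintegral_eq_abs_det_mul_lintegral_comp_linearMap {E : Type*} [NormedAddCommGroup E]
    [NormedSpace ℝ E] [FiniteDimensional ℝ E] [MeasurableSpace E] [BorelSpace E]
    (ν : Measure E) [ν.IsAddHaarMeasure] {T : E →ₗ[ℝ] E} (hT : LinearMap.det T ≠ 0)
    {H : E → ℝ≥0∞} (hH : Measurable H) :
    ∫⁻ x, H x ∂ν = ENNReal.ofReal |LinearMap.det T| * ∫⁻ x, H (T x) ∂ν := by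
  have hTm : Measurable T := T.continuous_of_finiteDimensional.measurable
  rw [← lintegral_map hH hTm, Measure.map_linearMap_addHaar_eq_smul_addHaar ν hT,
    lintegral_smul_measure, smul_eq_mul, ← mul_assoc, ← ENNReal.ofReal_mul (by positivity),
    abs_inv, mul_inv_cancel₀ (by positivity), ENNReal.ofReal_one, one_mul]

theorem lintegral_mulVec_rows {m k : ℕ} (M : Matrix (Fin k) (Fin k) ℝ) (hM : M.det ≠ 0)
    {H : (Fin m → Fin k → ℝ) → ℝ≥0∞} (hH : Measurable H) :
    ∫⁻ X : Fin m → Fin k → ℝ, H X =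
      ENNReal.ofReal (|M.det| ^ m) * ∫⁻ X : Fin m → Fin k → ℝ, H fun i => M *ᵥ X i := by
  let T : (Fin m → Fin k → ℝ) →ₗ[ℝ] (Fin m → Fin k → ℝ) :=
    LinearMap.pi fun i => (Matrix.toLin' M).comp (LinearMap.proj i)
  have hdet : LinearMap.det T = M.det ^ m := by
    rw [LinearMap.det_pi]
    simp
  have hdet0 : LinearMap.det T ≠ 0 := by
    rw [hdet]
    exact pow_ne_zero _ hM
  rw [lintegral_eq_abs_det_mul_lintegral_comp_linearMap volume hdet0 hH, hdet, abs_pow]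
  rfl

theorem lintegral_invSqrtOneAddVecMulVec {m k : ℕ} (y : Fin k → ℝ)
    {H : (Fin m → Fin k → ℝ) → ℝ≥0∞} (hH : Measurable H) :
    ∫⁻ X : Fin m → Fin k → ℝ, H X =
      ENNReal.ofReal ((√(1 + ∑ j, y j ^ 2))⁻¹ ^ m) *
        ∫⁻ X : Fin m → Fin k → ℝ, H fun i => invSqrtOneAddVecMulVec y *ᵥ X i := by
  have hγ := one_le_sqrt_one_add_sum_sq y
  rw [lintegral_mulVec_rows (invSqrtOneAddVecMulVec y) _ hH, det_invSqrtOneAddVecMulVec,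
    abs_of_pos (by positivity)]
  rw [det_invSqrtOneAddVecMulVec]
  positivity

theorem measurable_det_of {m : ℕ} :
    Measurable fun B : Fin m → Fin m → ℝ => (Matrix.of B).det := by
  have : Continuous fun B : Fin m → Fin m → ℝ => (Matrix.of B).det :=
    Continuous.matrix_det continuous_id
  exact this.measurable

/-- The absolute value of the determinant of a square array of real numbers. -/
noncomputable def absDet {m : ℕ} (B : Fin m → Fin m → ℝ) : ℝ≥0∞ :=
  ENNReal.ofReal |(Matrix.of B).det|

@[fun_prop]
theorem measurable_absDet {m : ℕ} : Measurable (absDet (m := m)) := by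
  have hdet := measurable_det_of (m := m)
  unfold absDet
  fun_prop

theorem measurable_inv_of_mulVec {m : ℕ} :
    Measurable fun q : (Fin m → Fin m → ℝ) × (Fin m → ℝ) => (Matrix.of q.1)⁻¹ *ᵥ q.2 := by
  have hadj : Continuous fun q : (Fin m → Fin m → ℝ) × (Fin m → ℝ) =>
      (Matrix.of q.1).adjugate *ᵥ q.2 :=
    Continuous.matrix_mulVec (Continuous.matrix_adjugate continuous_fst) continuous_snd
  have hdet : Measurable fun q : (Fin m → Fin m → ℝ) × (Fin m → ℝ) => (Matrix.of q.1).det :=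
    measurable_det_of.comp measurable_fst
  simp only [Matrix.inv_def, Ring.inverse_eq_inv', smul_mulVec]
  exact hdet.inv.smul hadj.measurable

theorem ae_det_of_ne_zero (m : ℕ) :
    ∀ᵐ B : Fin m → Fin m → ℝ, (Matrix.of B).det ≠ 0 := by
  let D : Fin m → Fin m → ℝ := (1 : Matrix (Fin m) (Fin m) ℝ)
  have hmeas : MeasurableSet {q : (Fin m → Fin m → ℝ) × ℝ |
      (Matrix.of (q.1 + q.2 • D)).det ≠ 0} := by
    have : Measurable fun q : (Fin m → Fin m → ℝ) × ℝ => (Matrix.of (q.1 + q.2 • D)).det :=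
      measurable_det_of.comp (by fun_prop)
    exact (this (measurableSet_singleton 0)).compl
  have hae : ∀ᵐ B : Fin m → Fin m → ℝ, ∀ᵐ t : ℝ, (Matrix.of (B + t • D)).det ≠ 0 := by
    refine Filter.Eventually.of_forall fun B => ?_
    have hne : (-(Matrix.of B)).charpoly ≠ 0 := (Matrix.charpoly_monic _).ne_zero
    have hfin : {t : ℝ | (-(Matrix.of B)).charpoly.IsRoot t}.Finite :=
      Polynomial.finite_setOfPred_isRoot hne
    refine (hfin.countable.ae_notMem volume).mono fun t ht hdet => ht ?_
    rw [Set.mem_ofPred_eq, Polynomial.IsRoot, Matrix.eval_charpoly, sub_neg_eq_add, ← hdet,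
      add_comm, Matrix.scalar_apply, ← Matrix.smul_one_eq_diagonal]
    rfl
  obtain ⟨t, ht⟩ := ((Measure.ae_ae_comm hmeas).1 hae).exists
  have hshift := (measurePreserving_add_right (volume : Measure (Fin m → Fin m → ℝ))
    (-(t • D))).quasiMeasurePreserving.ae ht
  filter_upwards [hshift] with B hB
  simpa using hB

theorem measurePreserving_append (m n : ℕ) :
    MeasurePreserving (fun q : (Fin m → Fin m → ℝ) × (Fin m → Fin n → ℝ) =>
      fun i => Fin.append (q.1 i) (q.2 i)) volume volume := by
  have h1 : MeasurePreserving (fun q : (Fin m → ℝ) × (Fin n → ℝ) => Fin.append q.1 q.2)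
      volume volume := by
    have := (volume_measurePreserving_piCongrLeft (fun _ : Fin (m + n) => ℝ)
      (finSumFinEquiv (m := m) (n := n))).comp
      (volume_measurePreserving_sumPiEquivProdPi_symm (fun _ : Fin m ⊕ Fin n => ℝ))
    convert this using 1
    funext q j
    refine Fin.addCases (fun i => ?_) (fun i => ?_) j
    · have := Equiv.piCongrLeft_apply_apply (fun _ : Fin (m + n) => ℝ) finSumFinEquiv
        ((MeasurableEquiv.sumPiEquivProdPi fun _ : Fin m ⊕ Fin n => ℝ).symm q) (Sum.inl i)
      rw [Fin.append_left]
      exact this.symm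
    · have := Equiv.piCongrLeft_apply_apply (fun _ : Fin (m + n) => ℝ) finSumFinEquiv
        ((MeasurableEquiv.sumPiEquivProdPi fun _ : Fin m ⊕ Fin n => ℝ).symm q) (Sum.inr i)
      rw [Fin.append_right]
      exact this.symm
  exact (volume_preserving_pi fun _ : Fin m => h1).comp
    (volume_measurePreserving_arrowProdEquivProdArrow (Fin m → ℝ) (Fin n → ℝ) (Fin m)).symm

theorem lintegral_comp_inv_mulVec {m : ℕ} {B : Matrix (Fin m) (Fin m) ℝ} (hB : B.det ≠ 0)
    (w : Fin m → ℝ) {H : (Fin m → ℝ) → (Fin m → ℝ) → ℝ≥0∞}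
    (hH : Measurable fun q : (Fin m → ℝ) × (Fin m → ℝ) => H q.1 q.2) :
    ∫⁻ b, H (B⁻¹ *ᵥ (b - w)) b =
      ENNReal.ofReal |B.det| * ∫⁻ z, H z (B *ᵥ z + w) := by
  have hdet : LinearMap.det (Matrix.toLin' B) ≠ 0 := by rwa [LinearMap.det_toLin']
  have hinv : Measurable fun b : Fin m → ℝ => B⁻¹ *ᵥ b :=
    (Continuous.matrix_mulVec continuous_const continuous_id).measurable
  have hmeas : Measurable fun b : Fin m → ℝ => H (B⁻¹ *ᵥ b) (b + w) :=
    hH.comp (hinv.prodMk (by fun_prop))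
  rw [← lintegral_add_right_eq_self _ w]
  simp only [add_sub_cancel_right]
  rw [lintegral_eq_abs_det_mul_lintegral_comp_linearMap volume hdet hmeas, LinearMap.det_toLin']
  simp only [Matrix.toLin'_apply, mulVec_mulVec, Matrix.nonsing_inv_mul B (Ne.isUnit hB),
    one_mulVec]

theorem lintegral_abs_det_mul_comp_sum_sq {m : ℕ} (y : Fin m → ℝ) {G : ℝ → ℝ≥0∞}
    (hG : Measurable G) (c : ℝ) :
    ∫⁻ B : Fin m → Fin m → ℝ, absDet B *
        G (c + ∑ i, (∑ j, B i j ^ 2 + (∑ j, B i j * y j) ^ 2)) =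
      ENNReal.ofReal ((√(1 + ∑ j, y j ^ 2))⁻¹ ^ (m + 1)) *
        ∫⁻ B : Fin m → Fin m → ℝ, absDet B *
          G (c + ∑ i, ∑ j, B i j ^ 2) := by
  have hγ := one_le_sqrt_one_add_sum_sq y
  have hmul (B : Fin m → Fin m → ℝ) :
      (Matrix.of fun i => invSqrtOneAddVecMulVec y *ᵥ B i).det =
        (Matrix.of B).det * (√(1 + ∑ j, y j ^ 2))⁻¹ := by
    rw [← det_invSqrtOneAddVecMulVec y, ← det_transpose (invSqrtOneAddVecMulVec y), ← det_mul]
    congr 1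
    ext i j
    simp [mul_apply, mulVec, dotProduct, mul_comm]
  rw [lintegral_invSqrtOneAddVecMulVec y (by fun_prop)]
  simp only [sum_sq_add_sq_invSqrtOneAddVecMulVec, absDet, hmul, abs_mul]
  rw [abs_of_pos (inv_pos.2 (zero_lt_one.trans_le hγ)), pow_succ,
    ENNReal.ofReal_mul (by positivity), mul_assoc]
  congr 1
  rw [← lintegral_const_mul' _ _ ENNReal.ofReal_ne_top]
  refine lintegral_congr fun B => ?_
  rw [mul_comm |_|, ENNReal.ofReal_mul (by positivity), mul_assoc]

theorem lintegral_comp_sum_sq_add_sq {m n : ℕ} (u : Fin n → ℝ) (p : Fin m → ℝ) {G : ℝ → ℝ≥0∞}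
    (hG : Measurable G) (c : ℝ) :
    ∫⁻ X : Fin m → Fin n → ℝ, G (c + ∑ i, (∑ j, X i j ^ 2 + (p i + ∑ j, X i j * u j) ^ 2)) =
      ENNReal.ofReal ((√(1 + ∑ j, u j ^ 2))⁻¹ ^ m) *
        ∫⁻ X : Fin m → Fin n → ℝ,
          G (c + ∑ i, (p i / √(1 + ∑ j, u j ^ 2)) ^ 2 + ∑ i, ∑ j, X i j ^ 2) := by
  have hβ := one_le_sqrt_one_add_sum_sq u
  have hsq : √(1 + ∑ j, u j ^ 2) ^ 2 = 1 + ∑ j, u j ^ 2 := Real.sq_sqrt (by positivity)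
  set β := √(1 + ∑ j, u j ^ 2) with hβ_def
  have hs : ∑ j, u j ^ 2 = β ^ 2 - 1 := by linarith
  have hrow (x : Fin n → ℝ) (a : ℝ) :
      ∑ j, (x j - a / β ^ 2 * u j) ^ 2 + (a + ∑ j, (x j - a / β ^ 2 * u j) * u j) ^ 2 =
        (a / β) ^ 2 + (∑ j, x j ^ 2 + (∑ j, x j * u j) ^ 2) := by
    have h1 (t : ℝ) : ∑ j, (x j - t * u j) ^ 2 =
        ∑ j, x j ^ 2 - 2 * t * ∑ j, x j * u j + t ^ 2 * (β ^ 2 - 1) := by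
      rw [← hs, Finset.mul_sum, Finset.mul_sum, ← Finset.sum_sub_distrib,
        ← Finset.sum_add_distrib]
      exact Finset.sum_congr rfl fun j _ => by ring
    have h2 (t : ℝ) : ∑ j, (x j - t * u j) * u j = ∑ j, x j * u j - t * (β ^ 2 - 1) := by
      rw [← hs, Finset.mul_sum, ← Finset.sum_sub_distrib]
      exact Finset.sum_congr rfl fun j _ => by ring
    rw [h1, h2]
    field_simp
    ring
  rw [← lintegral_sub_right_eq_self _ fun i j => p i / β ^ 2 * u j]
  simp only [Pi.sub_apply, hrow, Finset.sum_add_distrib]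
  simp only [← Finset.sum_add_distrib, ← add_assoc]
  rw [lintegral_invSqrtOneAddVecMulVec u (by fun_prop), ← hβ_def]
  simp only [add_assoc, Finset.sum_add_distrib]
  simp only [← Finset.sum_add_distrib, sum_sq_add_sq_invSqrtOneAddVecMulVec]

theorem inv_pow_mul_inv_sqrt_pow {m : ℕ} {β : ℝ} (hβ : 0 < β) (z : Fin m → ℝ) :
    β⁻¹ ^ m * (√(1 + ∑ j, (z j / β) ^ 2))⁻¹ ^ (m + 1) =
      β * (β ^ 2 + ∑ i, z i ^ 2) ^ (-((m : ℝ) + 1) / 2) := by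
  have hr : 0 < β ^ 2 + ∑ i, z i ^ 2 := by positivity
  have h1 : 1 + ∑ j, (z j / β) ^ 2 = (β ^ 2 + ∑ i, z i ^ 2) / β ^ 2 := by
    simp only [div_pow, ← Finset.sum_div]
    field_simp
  have h2 : (β ^ 2 + ∑ i, z i ^ 2) ^ (-((m : ℝ) + 1) / 2) =
      (√(β ^ 2 + ∑ i, z i ^ 2))⁻¹ ^ (m + 1) := by
    rw [Real.sqrt_eq_rpow, ← Real.rpow_neg hr.le, ← Real.rpow_natCast _ (m + 1),
      ← Real.rpow_mul hr.le]
    congr 1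
    push_cast
    ring
  rw [h1, h2, Real.sqrt_div hr.le, Real.sqrt_sq hβ.le]
  have := Real.sqrt_pos.2 hr
  rw [inv_div, div_eq_mul_inv, mul_pow, ← mul_assoc, pow_succ β, ← mul_assoc, ← mul_pow,
    inv_mul_cancel₀ hβ.ne', one_pow, one_mul]

theorem lintegral_comp_solution {m n : ℕ} (u : Fin n → ℝ) {G : ℝ → ℝ≥0∞} (hG : Measurable G)
    {g : (Fin m → ℝ) → ℝ≥0∞} (hg : Measurable g) :
    ∫⁻ B : Fin m → Fin m → ℝ, ∫⁻ X : Fin m → Fin n → ℝ, ∫⁻ b : Fin m → ℝ,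
        G (∑ i, ∑ j, B i j ^ 2 + ∑ i, ∑ j, X i j ^ 2 + ∑ i, b i ^ 2) *
          g ((Matrix.of B)⁻¹ *ᵥ (b - Matrix.of X *ᵥ u)) =
      (∫⁻ X : Fin m → Fin n → ℝ, ∫⁻ B : Fin m → Fin m → ℝ,
        absDet B * G (∑ i, ∑ j, X i j ^ 2 + ∑ i, ∑ j, B i j ^ 2)) *
      ∫⁻ z : Fin m → ℝ, ENNReal.ofReal (√(1 + ∑ j, u j ^ 2) *
        (√(1 + ∑ j, u j ^ 2) ^ 2 + ∑ i, z i ^ 2) ^ (-((m : ℝ) + 1) / 2)) * g z := by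
  have hβ := one_le_sqrt_one_add_sum_sq u
  set β := √(1 + ∑ j, u j ^ 2) with hβ_def
  have hβ0 : 0 < β := by linarith
  calc
    _ = ∫⁻ B : Fin m → Fin m → ℝ, ∫⁻ X : Fin m → Fin n → ℝ, ∫⁻ z : Fin m → ℝ,
          absDet B * (G (∑ i, ∑ j, B i j ^ 2 +
            ∑ i, (∑ j, X i j ^ 2 + (∑ j, B i j * z j + ∑ j, X i j * u j) ^ 2)) * g z) := by
      refine lintegral_congr_ae ((ae_det_of_ne_zero m).mono fun B hB => ?_)
      refine lintegral_congr fun X => ?_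
      rw [lintegral_comp_inv_mulVec hB _ (H := fun z b =>
          G (∑ i, ∑ j, B i j ^ 2 + ∑ i, ∑ j, X i j ^ 2 + ∑ i, b i ^ 2) * g z) (by fun_prop),
        ← absDet, ← lintegral_const_mul' _ _ (by simp [absDet])]
      refine lintegral_congr fun z => ?_
      simp only [Finset.sum_add_distrib, add_assoc]
      rfl
    _ = ∫⁻ z : Fin m → ℝ, ∫⁻ B : Fin m → Fin m → ℝ, ∫⁻ X : Fin m → Fin n → ℝ,
          absDet B * (G (∑ i, ∑ j, B i j ^ 2 +
            ∑ i, (∑ j, X i j ^ 2 + (∑ j, B i j * z j + ∑ j, X i j * u j) ^ 2)) * g z) := by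
      refine Eq.trans (lintegral_congr fun B => lintegral_lintegral_swap
        (Measurable.aemeasurable (by fun_prop))) (lintegral_lintegral_swap ?_)
      refine Measurable.aemeasurable (Measurable.lintegral_prod_right' (f := fun r :
        ((Fin m → Fin m → ℝ) × (Fin m → ℝ)) × (Fin m → Fin n → ℝ) =>
        absDet r.1.1 * (G (∑ i, ∑ j, r.1.1 i j ^ 2 + ∑ i, (∑ j, r.2 i j ^ 2 +
          (∑ j, r.1.1 i j * r.1.2 j + ∑ j, r.2 i j * u j) ^ 2)) * g r.1.2)) ?_)
      fun_prop
    _ = ∫⁻ z : Fin m → ℝ, ENNReal.ofReal (β⁻¹ ^ m) *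
          (∫⁻ B : Fin m → Fin m → ℝ, ∫⁻ X : Fin m → Fin n → ℝ,
            absDet B * G (∑ i, ∑ j, X i j ^ 2 +
              ∑ i, (∑ j, B i j ^ 2 + (∑ j, B i j * (z j / β)) ^ 2))) * g z := by
      refine lintegral_congr fun z => ?_
      have hmeas : Measurable fun B : Fin m → Fin m → ℝ => ∫⁻ X : Fin m → Fin n → ℝ,
          absDet B * G (∑ i, ∑ j, X i j ^ 2 +
            ∑ i, (∑ j, B i j ^ 2 + (∑ j, B i j * (z j / β)) ^ 2)) := by
        refine Measurable.lintegral_prod_right' (f := fun r :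
          (Fin m → Fin m → ℝ) × (Fin m → Fin n → ℝ) => absDet r.1 * G (∑ i, ∑ j, r.2 i j ^ 2 +
            ∑ i, (∑ j, r.1 i j ^ 2 + (∑ j, r.1 i j * (z j / β)) ^ 2))) ?_
        fun_prop
      rw [mul_assoc, ← lintegral_mul_const _ hmeas,
        ← lintegral_const_mul' _ _ ENNReal.ofReal_ne_top]
      refine lintegral_congr fun B => ?_
      have hd : absDet B ≠ ∞ := ENNReal.ofReal_ne_top
      rw [lintegral_const_mul' _ _ hd, lintegral_const_mul' _ _ hd,
        lintegral_mul_const _ (by fun_prop), lintegral_comp_sum_sq_add_sq u _ hG, ← hβ_def]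
      have hdiv (i : Fin m) : ∑ j, B i j * (z j / β) = (∑ j, B i j * z j) / β := by
        rw [Finset.sum_div]
        exact Finset.sum_congr rfl fun j _ => by ring
      simp only [hdiv, Finset.sum_add_distrib, add_comm (∑ i, ∑ j, _)]
      ring
    _ = ∫⁻ z : Fin m → ℝ, (∫⁻ X : Fin m → Fin n → ℝ, ∫⁻ B : Fin m → Fin m → ℝ,
          absDet B * G (∑ i, ∑ j, X i j ^ 2 + ∑ i, ∑ j, B i j ^ 2)) *
          (ENNReal.ofReal (β * (β ^ 2 + ∑ i, z i ^ 2) ^ (-((m : ℝ) + 1) / 2)) * g z) := by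
      refine lintegral_congr fun z => ?_
      rw [lintegral_lintegral_swap (Measurable.aemeasurable (by fun_prop))]
      simp only [lintegral_abs_det_mul_comp_sum_sq (fun j => z j / β) hG]
      rw [lintegral_const_mul' _ _ ENNReal.ofReal_ne_top, ← inv_pow_mul_inv_sqrt_pow hβ0,
        ENNReal.ofReal_mul (by positivity)]
      ring
    _ = _ := lintegral_const_mul _ (by fun_prop)

theorem measurable_solution (m n : ℕ) (u : Fin n → ℝ) :
    Measurable fun p : (Fin m → Fin (m + n) → ℝ) × (Fin m → ℝ) =>
      ((Matrix.of p.1).submatrix id (Fin.castAdd n))⁻¹ *ᵥ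
        (p.2 - (Matrix.of p.1).submatrix id (Fin.natAdd m) *ᵥ u) := by
  have hB : Measurable fun p : (Fin m → Fin (m + n) → ℝ) × (Fin m → ℝ) =>
      (fun i j => p.1 i (Fin.castAdd n j) : Fin m → Fin m → ℝ) := by
    fun_prop
  have hX : Measurable fun p : (Fin m → Fin (m + n) → ℝ) × (Fin m → ℝ) =>
      p.2 - (Matrix.of p.1).submatrix id (Fin.natAdd m) *ᵥ u := by
    have : Measurable fun p : (Fin m → Fin (m + n) → ℝ) × (Fin m → ℝ) =>
        fun i => p.2 i - ∑ j, p.1 i (Fin.natAdd m j) * u j := by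
      fun_prop
    exact this
  have h := measurable_inv_of_mulVec.comp (hB.prodMk hX)
  exact h

/-- **Universal distribution of solutions of random linear systems.**
If `(A, b)` has density `f(tr Aᵀ A + bᵀ b)`, `A = (B, X)`, and `u ∈ ℝⁿ` is fixed,
then `z = B⁻¹(b − Xu)` has density
`(Γ((m+1)/2)/π^((m+1)/2)) · β · (β² + zᵀz)^(−(m+1)/2)` with `β = √(1 + uᵀu)`,
independently of `f`. -/
theorem universality_linear_system_solution (m n : ℕ) (hm : 1 ≤ m) (hn : 1 ≤ n)
    (f : ℝ → ℝ) (hf_meas : Measurable f) (hf_nonneg : ∀ x, 0 ≤ f x)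
    (μ : Measure ((Fin m → Fin (m + n) → ℝ) × (Fin m → ℝ)))
    (hμ : μ = volume.withDensity fun p =>
      ENNReal.ofReal (f (Matrix.trace ((Matrix.of p.1)ᵀ * Matrix.of p.1) + ∑ i, p.2 i ^ 2)))
    (hprob : IsProbabilityMeasure μ)
    (u : Fin n → ℝ) (β : ℝ) (hβ : β = Real.sqrt (1 + ∑ p, u p ^ 2)) :
    μ.map (fun p : (Fin m → Fin (m + n) → ℝ) × (Fin m → ℝ) =>
        ((Matrix.of p.1).submatrix id (Fin.castAdd n))⁻¹ *ᵥ
          (p.2 - (Matrix.of p.1).submatrix id (Fin.natAdd m) *ᵥ u))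
      = volume.withDensity fun z : Fin m → ℝ =>
          ENNReal.ofReal
            (Real.Gamma ((m + 1 : ℝ) / 2) / Real.pi ^ ((m + 1 : ℝ) / 2) * β *
              (β ^ 2 + ∑ i, z i ^ 2) ^ (-((m : ℝ) + 1) / 2)) := by
  have hβ1 : 1 ≤ β := hβ ▸ one_le_sqrt_one_add_sum_sq u
  have hβ0 : 0 < β := by linarith
  have hG : Measurable fun x => ENNReal.ofReal (f x) := by fun_prop
  set G : ℝ → ℝ≥0∞ := fun x => ENNReal.ofReal (f x) with hG_def
  set φ : (Fin m → Fin (m + n) → ℝ) × (Fin m → ℝ) → Fin m → ℝ := fun p =>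
    ((Matrix.of p.1).submatrix id (Fin.castAdd n))⁻¹ *ᵥ
      (p.2 - (Matrix.of p.1).submatrix id (Fin.natAdd m) *ᵥ u) with hφ_def
  have hφ : Measurable φ := measurable_solution m n u
  have htrace (A : Fin m → Fin (m + n) → ℝ) :
      Matrix.trace ((Matrix.of A)ᵀ * Matrix.of A) = ∑ i, ∑ j, A i j ^ 2 := by
    simp only [Matrix.trace, Matrix.diag_apply, Matrix.mul_apply, Matrix.transpose_apply,
      Matrix.of_apply, ← pow_two]
    exact Finset.sum_comm
  simp only [htrace] at hμ
  set K : ℝ≥0∞ := ∫⁻ X : Fin m → Fin n → ℝ, ∫⁻ B : Fin m → Fin m → ℝ,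
    absDet B * G (∑ i, ∑ j, X i j ^ 2 + ∑ i, ∑ j, B i j ^ 2)
  have hdens : Measurable fun p : (Fin m → Fin (m + n) → ℝ) × (Fin m → ℝ) =>
      G (∑ i, ∑ j, p.1 i j ^ 2 + ∑ i, p.2 i ^ 2) := by
    fun_prop
  have key {g : (Fin m → ℝ) → ℝ≥0∞} (hg : Measurable g) : ∫⁻ z, g z ∂(μ.map φ) =
      K * ∫⁻ z : Fin m → ℝ,
        ENNReal.ofReal (β * (β ^ 2 + ∑ i, z i ^ 2) ^ (-((m : ℝ) + 1) / 2)) * g z := by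
    have hgφ : Measurable fun p => g (φ p) := hg.comp hφ
    rw [hβ, ← lintegral_comp_solution u hG hg, lintegral_map hg hφ, hμ,
      lintegral_withDensity_eq_lintegral_mul _ hdens hgφ, Measure.volume_eq_prod,
      lintegral_prod _ (hdens.mul hgφ).aemeasurable,
      ← (measurePreserving_append m n).lintegral_comp (hdens.mul hgφ).lintegral_prod_right',
      Measure.volume_eq_prod, lintegral_prod]
    · refine lintegral_congr fun B => lintegral_congr fun X => lintegral_congr fun b => ?_
      have hleft : ((Matrix.of fun i => Fin.append (B i) (X i)).submatrix id (Fin.castAdd n)) =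
          Matrix.of B := by
        ext i j
        simp
      have hright : ((Matrix.of fun i => Fin.append (B i) (X i)).submatrix id (Fin.natAdd m)) =
          Matrix.of X := by
        ext i j
        simp
      simp only [Pi.mul_apply, hφ_def, hleft, hright, Fin.sum_univ_add, Fin.append_left,
        Fin.append_right, Finset.sum_add_distrib]
    · exact ((hdens.mul hgφ).lintegral_prod_right'.comp
        (measurePreserving_append m n).measurable).aemeasurable
  set C : ℝ := Real.Gamma ((m + 1 : ℝ) / 2) / Real.pi ^ ((m + 1 : ℝ) / 2)
  have hC : 0 < C := div_pos (Real.Gamma_pos_of_pos (by positivity)) (by positivity)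
  set h : (Fin m → ℝ) → ℝ≥0∞ := fun z =>
    ENNReal.ofReal (β * (β ^ 2 + ∑ i, z i ^ 2) ^ (-((m : ℝ) + 1) / 2)) with hh_def
  have hh : Measurable h := by fun_prop
  have hcauchy : ENNReal.ofReal C * ∫⁻ z, h z = 1 := by
    rw [← lintegral_multivariate_cauchy m hβ0,
      ← lintegral_const_mul' _ _ ENNReal.ofReal_ne_top]
    refine lintegral_congr fun z => ?_
    rw [hh_def, ← ENNReal.ofReal_mul hC.le, mul_assoc]
  have hmass : K * ∫⁻ z, h z = 1 := by
    have hmap : IsProbabilityMeasure (μ.map φ) := Measure.isProbabilityMeasure_map hφ.aemeasurable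
    have hone := key (g := fun _ => 1) measurable_const
    simp only [mul_one, lintegral_one, measure_univ] at hone
    exact hone.symm
  have hK : K = ENNReal.ofReal C :=
    calc K = K * (ENNReal.ofReal C * ∫⁻ z, h z) := by rw [hcauchy, mul_one]
      _ = ENNReal.ofReal C * (K * ∫⁻ z, h z) := by ring
      _ = ENNReal.ofReal C := by rw [hmass, mul_one]
  refine Measure.ext_of_lintegral _ fun g hg => ?_
  rw [key hg, hK, lintegral_withDensity_eq_lintegral_mul _ (by fun_prop) hg,
    ← lintegral_const_mul' _ _ ENNReal.ofReal_ne_top]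
  refine lintegral_congr fun z => ?_
  rw [Pi.mul_apply, ← mul_assoc, ← ENNReal.ofReal_mul hC.le, mul_assoc C]
end

section
/- Let m ≥ 1 and n ≥ 1 be integers and let f : ℝ → ℝ be a measurable nonnegative function with ∫ f(tr(Aᵀ A)) · |det B| dA < ∞, the integral over all real m×(m+n) matrices A, where B is the m×m matrix formed by the first m columns of A. Then for every z ∈ ℝ^m and u ∈ ℝⁿ, with ξ = (z; u) ∈ ℝ^{m+n} the concatenated vector, ∫ f(tr(Aᵀ A) + (Aξ)ᵀ(Aξ)) · |det B| dA = √(1 + uᵀu) · (1 + ξᵀξ)^(−(m+1)/2) · ∫ f(tr(Aᵀ A)) · |det B| dA. -/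
open MeasureTheory Matrix
open scoped ENNReal Real

/-- Right multiplication by an invertible matrix rescales Lebesgue measure on matrices. -/
theorem lintegral_comp_of_mul_right {ι κ : Type*} [Fintype ι] [Fintype κ] [DecidableEq κ]
    {R : Matrix κ κ ℝ} (hR : R.det ≠ 0) {F : (ι → κ → ℝ) → ℝ≥0∞} (hF : Measurable F) :
    ∫⁻ A : ι → κ → ℝ, F (Matrix.of A * R) =
      ENNReal.ofReal (|R.det|⁻¹ ^ Fintype.card ι) * ∫⁻ A : ι → κ → ℝ, F A := by
  let L : (ι → κ → ℝ) →ₗ[ℝ] (ι → κ → ℝ) :=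
    LinearMap.pi fun i => (Matrix.toLin' Rᵀ).comp (LinearMap.proj i)
  have hL : LinearMap.det L = R.det ^ Fintype.card ι := by
    simp only [L, LinearMap.det_pi, LinearMap.det_toLin', det_transpose, Finset.prod_const,
      Finset.card_univ]
  have hLA (A : ι → κ → ℝ) : L A = Matrix.of A * R := by
    funext i
    simp only [L, LinearMap.pi_apply, LinearMap.comp_apply, LinearMap.proj_apply, toLin'_apply,
      mulVec_transpose]
    rfl
  have hLm : Measurable L := (LinearMap.continuous_of_finiteDimensional L).measurable
  have hmap := Measure.map_linearMap_addHaar_eq_smul_addHaar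
    (volume : Measure (ι → κ → ℝ)) (f := L) (by rw [hL]; exact pow_ne_zero _ hR)
  have h := lintegral_map (μ := volume) hF hLm
  rw [hmap, lintegral_smul_measure, hL] at h
  simp only [hLA] at h
  rw [← h, abs_inv, abs_pow, inv_pow, smul_eq_mul]

/-- An explicit square root of `1 + k v vᵀ`. -/
theorem exists_mul_transpose_eq_one_add_smul_vecMulVec {ι : Type*} [Fintype ι] [DecidableEq ι]
    (v : ι → ℝ) {k : ℝ} (hk : 0 ≤ k) :
    ∃ R : Matrix ι ι ℝ, R * Rᵀ = 1 + k • vecMulVec v v ∧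
      R.det = √(1 + k * (v ⬝ᵥ v)) ∧ R *ᵥ v = √(1 + k * (v ⬝ᵥ v)) • v := by
  have ht : 0 ≤ v ⬝ᵥ v := Finset.sum_nonneg fun i _ => mul_self_nonneg (v i)
  set t := v ⬝ᵥ v with htd
  have hd := Real.sq_sqrt (show 0 ≤ 1 + k * t by positivity)
  have hd0 := Real.sqrt_nonneg (1 + k * t)
  set d := √(1 + k * t)
  obtain ⟨a, ha⟩ : ∃ a, a = k / (1 + d) := ⟨_, rfl⟩
  have hat : a * t = d - 1 := by
    rw [ha]
    field_simp
    linarith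
  have hak : a + a * d = k := by
    rw [ha]
    field_simp
  refine ⟨1 + a • vecMulVec v v, ?_, ?_, ?_⟩
  · rw [transpose_add, transpose_smul, transpose_vecMulVec, transpose_one, add_mul, mul_add,
      mul_add, one_mul, one_mul, mul_one, smul_mul_smul_comm, vecMulVec_mul_vecMulVec,
      ← htd, vecMulVec_smul, smul_smul, add_assoc, ← add_smul, ← add_smul]
    congr 2
    linear_combination a * hat + hak
  · rw [← smul_vecMulVec, vecMulVec_eq Unit, det_one_add_replicateCol_mul_replicateRow,
      dotProduct_smul, ← htd, smul_eq_mul]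
    linarith
  · rw [add_mulVec, one_mulVec, smul_mulVec, vecMulVec_mulVec, ← htd]
    ext i
    simp only [Pi.add_apply, Pi.smul_apply, smul_eq_mul, MulOpposite.smul_eq_mul_unop,
      MulOpposite.unop_op]
    linear_combination v i * hat

/-- A block upper triangular factor of `1 + ξ ξᵀ` for `ξ = (z; u)`. -/
theorem exists_fromBlocks_mul_transpose_eq_one_add_vecMulVec {ι κ : Type*} [Fintype ι]
    [DecidableEq ι] [Fintype κ] [DecidableEq κ] (z : ι → ℝ) (u : κ → ℝ) :
    ∃ (R₁ : Matrix ι ι ℝ) (X : Matrix ι κ ℝ) (R₂ : Matrix κ κ ℝ),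
      fromBlocks R₁ X 0 R₂ * (fromBlocks R₁ X 0 R₂)ᵀ =
        1 + vecMulVec (Sum.elim z u) (Sum.elim z u) ∧
      R₁.det = √(1 + z ⬝ᵥ z + u ⬝ᵥ u) / √(1 + u ⬝ᵥ u) ∧ R₂.det = √(1 + u ⬝ᵥ u) := by
  have hs : 0 ≤ u ⬝ᵥ u := Finset.sum_nonneg fun i _ => mul_self_nonneg (u i)
  obtain ⟨R₂, hR₂, hdet₂, hu⟩ :=
    exists_mul_transpose_eq_one_add_smul_vecMulVec u zero_le_one
  rw [one_mul] at hdet₂ hu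
  rw [one_smul] at hR₂
  obtain ⟨R₁, hR₁, hdet₁, -⟩ :=
    exists_mul_transpose_eq_one_add_smul_vecMulVec z
      (show 0 ≤ (1 + u ⬝ᵥ u)⁻¹ by positivity)
  have hd := Real.sq_sqrt (show 0 ≤ 1 + u ⬝ᵥ u by positivity)
  have hd0 : 0 < √(1 + u ⬝ᵥ u) := Real.sqrt_pos.2 (by positivity)
  set d := √(1 + u ⬝ᵥ u)
  have hX : vecMulVec z u * R₂ᵀ = d • vecMulVec z u := by
    rw [vecMulVec_mul, vecMul_transpose, hu, vecMulVec_smul]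
  refine ⟨R₁, d⁻¹ • vecMulVec z u, R₂, ?_, ?_, hdet₂⟩
  · have h₁₂ : (d⁻¹ • vecMulVec z u) * R₂ᵀ = vecMulVec z u := by
      rw [smul_mul, hX, smul_smul, inv_mul_cancel₀ hd0.ne', one_smul]
    have h₂₁ : R₂ * (d⁻¹ • vecMulVec z u)ᵀ = vecMulVec u z := by
      rw [← transpose_transpose R₂, ← transpose_mul, h₁₂, transpose_vecMulVec]
    have h₁₁ : R₁ * R₁ᵀ + (d⁻¹ • vecMulVec z u) * (d⁻¹ • vecMulVec z u)ᵀ =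
        1 + vecMulVec z z := by
      rw [hR₁, transpose_smul, transpose_vecMulVec, Matrix.smul_mul, Matrix.mul_smul, smul_smul,
        vecMulVec_mul_vecMulVec, vecMulVec_smul, smul_smul, add_assoc, ← add_smul]
      have : (1 + u ⬝ᵥ u)⁻¹ + d⁻¹ * d⁻¹ * u ⬝ᵥ u = 1 := by
        rw [← hd]
        field_simp
        linarith
      rw [this, one_smul]
    rw [fromBlocks_transpose, fromBlocks_multiply, h₁₁]
    simp only [transpose_zero, Matrix.mul_zero, Matrix.zero_mul, zero_add, h₁₂, h₂₁, hR₂]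
    ext (i | i) (j | j) <;> simp [vecMulVec_apply, one_apply]
  · rw [hdet₁, ← Real.sqrt_div' _ (by positivity)]
    congr 1
    field_simp
    ring

/-- The same factor indexed by `Fin (m + n)`: right multiplication by it scales the determinant
of the first `m` columns by a constant. -/
theorem exists_mul_transpose_eq_one_add_vecMulVec_append {m n : ℕ} (z : Fin m → ℝ)
    (u : Fin n → ℝ) :
    ∃ R : Matrix (Fin (m + n)) (Fin (m + n)) ℝ,
      R * Rᵀ = 1 + vecMulVec (Fin.append z u) (Fin.append z u) ∧
      R.det = √(1 + ∑ α, Fin.append z u α ^ 2) ∧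
      ∀ A : Matrix (Fin m) (Fin (m + n)) ℝ,
        ((A * R).submatrix id (Fin.castAdd n)).det =
          (A.submatrix id (Fin.castAdd n)).det *
            (√(1 + ∑ α, Fin.append z u α ^ 2) / √(1 + ∑ p, u p ^ 2)) := by
  obtain ⟨R₁, X, R₂, hR, h₁, h₂⟩ :=
    exists_fromBlocks_mul_transpose_eq_one_add_vecMulVec z u
  have hs : u ⬝ᵥ u = ∑ p, u p ^ 2 := by simp [dotProduct, pow_two]
  have hst : 1 + z ⬝ᵥ z + u ⬝ᵥ u = 1 + ∑ α, Fin.append z u α ^ 2 := by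
    simp [dotProduct, pow_two, Fin.sum_univ_add, add_assoc]
  have happ : Fin.append z u = Sum.elim z u ∘ finSumFinEquiv.symm := by
    ext i
    refine Fin.addCases (fun i => ?_) (fun i => ?_) i <;> simp
  rw [hst, hs] at h₁
  rw [hs] at h₂
  have hpos : 0 < √(1 + ∑ p, u p ^ 2) := Real.sqrt_pos.2 (by positivity)
  refine ⟨(fromBlocks R₁ X 0 R₂).submatrix finSumFinEquiv.symm finSumFinEquiv.symm,
    ?_, ?_, fun A => ?_⟩
  · rw [transpose_submatrix, submatrix_mul_equiv, hR, happ]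
    ext i j
    simp [vecMulVec_apply, one_apply]
  · rw [det_submatrix_equiv_self, det_fromBlocks_zero₂₁, h₁, h₂, div_mul_cancel₀ _ hpos.ne']
  · rw [← h₁, ← det_mul]
    congr 1
    ext i j
    simp [mul_apply, Fin.sum_univ_add]

/-- Key integral identity: for `ξ = (z; u)`,
`∫ f(tr Aᵀ A + (Aξ)ᵀ(Aξ)) |det B| dA
  = √(1 + uᵀu) (1 + ξᵀξ)^(−(m+1)/2) ∫ f(tr Aᵀ A) |det B| dA`. -/
theorem P_explicit_factor (m n : ℕ) (hm : 1 ≤ m) (hn : 1 ≤ n)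
    (f : ℝ → ℝ) (hf_meas : Measurable f) (hf_nonneg : ∀ x, 0 ≤ f x)
    (hfin : (∫⁻ A : Fin m → Fin (m + n) → ℝ,
        ENNReal.ofReal (f (Matrix.trace ((Matrix.of A)ᵀ * Matrix.of A)) *
          |Matrix.det ((Matrix.of A).submatrix id (Fin.castAdd n))|)) ≠ ⊤)
    (z : Fin m → ℝ) (u : Fin n → ℝ) :
    (∫⁻ A : Fin m → Fin (m + n) → ℝ,
        ENNReal.ofReal
          (f (Matrix.trace ((Matrix.of A)ᵀ * Matrix.of A) +
              ∑ i, (Matrix.of A *ᵥ Fin.append z u) i ^ 2) *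
            |Matrix.det ((Matrix.of A).submatrix id (Fin.castAdd n))|))
      = ENNReal.ofReal
          (Real.sqrt (1 + ∑ p, u p ^ 2) *
            (1 + ∑ α, Fin.append z u α ^ 2) ^ (-((m : ℝ) + 1) / 2)) *
        ∫⁻ A : Fin m → Fin (m + n) → ℝ,
          ENNReal.ofReal (f (Matrix.trace ((Matrix.of A)ᵀ * Matrix.of A)) *
            |Matrix.det ((Matrix.of A).submatrix id (Fin.castAdd n))|) := by
  obtain ⟨R, hR, hdet, hsub⟩ := exists_mul_transpose_eq_one_add_vecMulVec_append z u
  set ξ := Fin.append z u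
  have hX : 0 < 1 + ∑ α, ξ α ^ 2 := by positivity
  have hd0 : 0 < √(1 + ∑ α, ξ α ^ 2) := Real.sqrt_pos.2 hX
  have hs0 : 0 < √(1 + ∑ p, u p ^ 2) := Real.sqrt_pos.2 (by positivity)
  have hpow : (1 + ∑ α, ξ α ^ 2) ^ (-((m : ℝ) + 1) / 2) = (√(1 + ∑ α, ξ α ^ 2))⁻¹ ^ (m + 1) := by
    rw [Real.sqrt_eq_rpow, ← Real.rpow_neg hX.le, ← Real.rpow_natCast, ← Real.rpow_mul hX.le]
    congr 1
    push_cast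
    ring
  have htr (A : Matrix (Fin m) (Fin (m + n)) ℝ) :
      trace ((A * R)ᵀ * (A * R)) = trace (Aᵀ * A) + ∑ i, (A *ᵥ ξ) i ^ 2 := by
    rw [trace_mul_comm, transpose_mul, ← Matrix.mul_assoc, Matrix.mul_assoc A, hR, Matrix.mul_add,
      Matrix.add_mul, Matrix.mul_one, trace_add, trace_mul_comm A, mul_vecMulVec, vecMulVec_mul,
      vecMul_transpose, trace_vecMulVec]
    simp only [dotProduct, pow_two]
  set F : (Fin m → Fin (m + n) → ℝ) → ℝ≥0∞ := fun A =>
    ENNReal.ofReal (f (trace ((Matrix.of A)ᵀ * Matrix.of A)) *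
      |det ((Matrix.of A).submatrix id (Fin.castAdd n))|) with hFdef
  have hF : Measurable F := by
    have h₁ : Continuous fun A : Fin m → Fin (m + n) → ℝ =>
        trace ((Matrix.of A)ᵀ * Matrix.of A) := by
      have : Continuous fun A : Fin m → Fin (m + n) → ℝ => Matrix.of A := continuous_id
      exact (this.matrix_transpose.matrix_mul this).matrix_trace
    have h₂ : Continuous fun A : Fin m → Fin (m + n) → ℝ =>
        |det ((Matrix.of A).submatrix id (Fin.castAdd n))| := by
      have : Continuous fun A : Fin m → Fin (m + n) → ℝ => Matrix.of A := continuous_id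
      exact (this.matrix_submatrix _ _).matrix_det.abs
    exact ((hf_meas.comp h₁.measurable).mul h₂.measurable).ennreal_ofReal
  have hRm : Measurable fun A : Fin m → Fin (m + n) → ℝ => F (Matrix.of A * R) := by
    refine hF.comp (Continuous.measurable ?_)
    have : Continuous fun A : Fin m → Fin (m + n) → ℝ => Matrix.of A := continuous_id
    exact this.matrix_mul continuous_const
  have hpt (A : Fin m → Fin (m + n) → ℝ) :
      ENNReal.ofReal (f (trace ((Matrix.of A)ᵀ * Matrix.of A) +
          ∑ i, (Matrix.of A *ᵥ ξ) i ^ 2) * |det ((Matrix.of A).submatrix id (Fin.castAdd n))|) =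
        ENNReal.ofReal (√(1 + ∑ p, u p ^ 2) / √(1 + ∑ α, ξ α ^ 2)) * F (Matrix.of A * R) := by
    have hFA : F (Matrix.of A * R) = ENNReal.ofReal (f (trace ((Matrix.of A * R)ᵀ *
        (Matrix.of A * R))) * |det ((Matrix.of A * R).submatrix id (Fin.castAdd n))|) := rfl
    rw [hFA, ← ENNReal.ofReal_mul (by positivity), htr, hsub, abs_mul,
      abs_of_pos (div_pos hd0 hs0)]
    congr 1
    field_simp
  have hdet0 : R.det ≠ 0 := by rw [hdet]; exact hd0.ne'
  rw [lintegral_congr hpt, lintegral_const_mul _ hRm, lintegral_comp_of_mul_right hdet0 hF,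
    ← mul_assoc, ← ENNReal.ofReal_mul (by positivity), hdet, abs_of_pos hd0, hpow,
    Fintype.card_fin, pow_succ', div_eq_mul_inv, mul_assoc]
end

section
/- Let m ≥ 1 and n ≥ 1 be integers, and let f : ℝ → ℝ be a measurable nonnegative function such that the measure on pairs (A, b), with A a real m×(m+n) matrix and b ∈ ℝ^m, with density (A, b) ↦ f(tr(Aᵀ A) + bᵀ b) with respect to Lebesgue measure, is a probability measure (equivalently, ∫₀^∞ u^{m(m+n+1)/2 − 1} f(u) du = Γ(m(m+n+1)/2)/π^{m(m+n+1)/2}). Then ∫ f(tr(Aᵀ A)) · |det B| dA = Γ((m+1)/2)/π^((m+1)/2), where the integral is over all real m×(m+n) matrices A and B is the m×m matrix formed by the first m columns of A. In particular this integral is finite and independent of f. -/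
open MeasureTheory Matrix
open scoped ENNReal Real

theorem lintegral_norm_pow_mul_exp_neg_sq (k s : ℕ) :
    ∫⁻ x : Fin (k + 1) → ℝ, ENNReal.ofReal (√(∑ i, x i ^ 2) ^ s * Real.exp (-∑ i, x i ^ 2)) =
      ENNReal.ofReal (π ^ ((k + 1 : ℝ) / 2) * Real.Gamma ((k + 1 + s : ℝ) / 2) /
        Real.Gamma ((k + 1 : ℝ) / 2)) := by
  set F : ℝ → ℝ := fun r => r ^ s * Real.exp (-r ^ 2) with hF
  have hpow : ∀ y : ℝ, y ^ k * F y = y ^ ((k + s : ℕ) : ℝ) * Real.exp (-y ^ (2 : ℝ)) := by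
    intro y
    rw [Real.rpow_natCast, Real.rpow_two, hF]
    ring
  have hq : (-1 : ℝ) < ((k + s : ℕ) : ℝ) := by
    have : (0 : ℝ) ≤ ((k + s : ℕ) : ℝ) := Nat.cast_nonneg _
    linarith
  have hdim : Module.finrank ℝ (EuclideanSpace ℝ (Fin (k + 1))) - 1 = k := by simp
  have hint : Integrable (fun x : EuclideanSpace ℝ (Fin (k + 1)) => F ‖x‖) := by
    rw [integrable_fun_norm_addHaar, hdim]
    simp only [smul_eq_mul, hpow]
    exact integrableOn_rpow_mul_exp_neg_rpow hq (by norm_num)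
  have hval : ∫ x : EuclideanSpace ℝ (Fin (k + 1)), F ‖x‖ =
      π ^ ((k + 1 : ℝ) / 2) * Real.Gamma ((k + 1 + s : ℝ) / 2) /
        Real.Gamma ((k + 1 : ℝ) / 2) := by
    rw [integral_fun_norm_addHaar, hdim]
    simp only [smul_eq_mul, hpow, nsmul_eq_mul]
    rw [integral_rpow_mul_exp_neg_rpow (by norm_num) hq, Measure.real,
      EuclideanSpace.volume_ball]
    have hG : Real.Gamma (((k + 1 : ℕ) : ℝ) / 2 + 1) =
        ((k + 1 : ℝ) / 2) * Real.Gamma ((k + 1 : ℝ) / 2) := by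
      push_cast
      exact Real.Gamma_add_one (by positivity)
    have hpi : √π ^ (k + 1) = π ^ ((k + 1 : ℝ) / 2) := by
      rw [Real.sqrt_eq_rpow, ← Real.rpow_natCast, ← Real.rpow_mul Real.pi_pos.le]
      congr 1
      push_cast
      ring
    have hG0 : 0 < Real.Gamma ((k + 1 : ℝ) / 2) := Real.Gamma_pos_of_pos (by positivity)
    simp only [ENNReal.ofReal_one, one_pow, one_mul, Fintype.card_fin, finrank_euclideanSpace]
    rw [ENNReal.toReal_ofReal (by rw [hG]; positivity), hG, hpi]
    have : ((k + s : ℕ) + 1 : ℝ) = k + 1 + s := by push_cast; ring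
    rw [this]
    push_cast
    field_simp
  have hpos : ∀ x : EuclideanSpace ℝ (Fin (k + 1)), 0 ≤ F ‖x‖ := fun x => by
    simp only [hF]
    positivity
  rw [← hval, ofReal_integral_eq_lintegral_ofReal hint (.of_forall hpos),
    ← (PiLp.volume_preserving_toLp (Fin (k + 1))).lintegral_comp
      (f := fun x => ENNReal.ofReal (F ‖x‖)) (by fun_prop)]
  congr 1 with x
  have hsum : 0 ≤ ∑ i, x i ^ 2 := Finset.sum_nonneg fun i _ => sq_nonneg _
  simp [hF, EuclideanSpace.norm_eq, Real.sq_sqrt hsum]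

theorem lintegral_exp_neg_sum_sq (k : ℕ) :
    ∫⁻ x : Fin k → ℝ, ENNReal.ofReal (Real.exp (-∑ i, x i ^ 2)) =
      ENNReal.ofReal (π ^ ((k : ℝ) / 2)) := by
  cases k with
  | zero => simp [volume_pi]
  | succ k =>
    have h := lintegral_norm_pow_mul_exp_neg_sq k 0
    have hG0 : Real.Gamma ((k + 1 : ℝ) / 2) ≠ 0 :=
      (Real.Gamma_pos_of_pos (by positivity)).ne'
    simpa [hG0] using h

theorem volume_preserving_splitColumn (m N : ℕ) (p : Fin (N + 1)) :
    MeasurePreserving (fun A : Fin m → Fin (N + 1) → ℝ =>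
      ((fun i => A i p, fun i j => A i (p.succAbove j)) : (Fin m → ℝ) × (Fin m → Fin N → ℝ))) :=
  (volume_measurePreserving_arrowProdEquivProdArrow ℝ (Fin N → ℝ) (Fin m)).comp
    (volume_preserving_pi fun _ : Fin m => volume_preserving_piFinSuccAbove (fun _ => ℝ) p)

theorem lintegral_gaussian_mul_of_removeColumn (m N : ℕ) (p : Fin (N + 1))
    (g : (Fin m → Fin N → ℝ) → ℝ≥0∞) (hg : Measurable g) :
    ∫⁻ A : Fin m → Fin (N + 1) → ℝ, ENNReal.ofReal (Real.exp (-∑ i, ∑ j, A i j ^ 2)) *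
        g (fun i j => A i (p.succAbove j)) =
      ENNReal.ofReal (π ^ ((m : ℝ) / 2)) *
        ∫⁻ A : Fin m → Fin N → ℝ, ENNReal.ofReal (Real.exp (-∑ i, ∑ j, A i j ^ 2)) * g A := by
  rw [← lintegral_exp_neg_sum_sq, ← lintegral_prod_mul
      (Measurable.aemeasurable (by fun_prop)) (Measurable.aemeasurable (by fun_prop)),
    ← Measure.volume_eq_prod, ← (volume_preserving_splitColumn m N p).lintegral_comp (by fun_prop)]
  congr 1 with A
  rw [← mul_assoc, ← ENNReal.ofReal_mul (Real.exp_nonneg _), ← Real.exp_add]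
  simp only [Fin.sum_univ_succAbove _ p, Finset.sum_add_distrib, neg_add]

theorem lintegral_gaussian_matrix (m N : ℕ) :
    ∫⁻ A : Fin m → Fin N → ℝ, ENNReal.ofReal (Real.exp (-∑ i, ∑ j, A i j ^ 2)) =
      ENNReal.ofReal (π ^ ((m : ℝ) / 2)) ^ N := by
  induction N with
  | zero =>
    have : ∀ _ : Fin m, IsProbabilityMeasure (volume : Measure (Fin 0 → ℝ)) := fun _ =>
      ⟨by simp [volume_pi]⟩
    have h : (volume : Measure (Fin m → Fin 0 → ℝ)) Set.univ = 1 := by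
      rw [volume_pi]
      exact measure_univ
    simp [h]
  | succ N ih =>
    have h := lintegral_gaussian_mul_of_removeColumn m N (Fin.last N) (fun _ => 1) (by fun_prop)
    simp only [mul_one] at h
    rw [h, ih, pow_succ']

theorem lintegral_comp_smul_addHaar {E : Type*} [NormedAddCommGroup E] [NormedSpace ℝ E]
    [MeasurableSpace E] [BorelSpace E] [FiniteDimensional ℝ E] (μ : Measure E)
    [μ.IsAddHaarMeasure] {t : ℝ} (ht : 0 < t) (F : E → ℝ≥0∞) :
    ∫⁻ x, F x ∂μ = ENNReal.ofReal (t ^ Module.finrank ℝ E) * ∫⁻ x, F (t • x) ∂μ := by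
  have h : ∫⁻ x, F (t • x) ∂μ = ∫⁻ x, F x ∂(μ.map (t • ·)) :=
    (lintegral_map_equiv F (Homeomorph.smulOfNeZero t ht.ne').toMeasurableEquiv).symm
  rw [h, Measure.map_addHaar_smul μ ht.ne', lintegral_smul_measure, smul_eq_mul, ← mul_assoc,
    ← ENNReal.ofReal_mul (by positivity), abs_of_pos (by positivity),
    mul_inv_cancel₀ (by positivity)]
  simp

/-- The image under `q` of the measure with density `g` with respect to `μ`. -/
noncomputable def radialMeasure {E : Type*} [MeasurableSpace E] (μ : Measure E)
    (q : E → ℝ) (g : E → ℝ≥0∞) : Measure ℝ :=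
  (μ.withDensity g).map q

theorem lintegral_radialMeasure {E : Type*} [MeasurableSpace E] (μ : Measure E)
    {q : E → ℝ} {g : E → ℝ≥0∞} (hq : Measurable q) (hg : Measurable g)
    {F : ℝ → ℝ≥0∞} (hF : Measurable F) :
    ∫⁻ r, F r ∂(radialMeasure μ q g) = ∫⁻ x, F (q x) * g x ∂μ := by
  rw [radialMeasure, lintegral_map hF hq,
    lintegral_withDensity_eq_lintegral_mul _ hg (g := fun x => F (q x)) (hF.comp hq)]
  simp [mul_comm]

theorem radialMeasure_Iio {E : Type*} [NormedAddCommGroup E] [NormedSpace ℝ E]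
    [MeasurableSpace E] [BorelSpace E] [FiniteDimensional ℝ E] (μ : Measure E)
    [μ.IsAddHaarMeasure] {q : E → ℝ} {g : E → ℝ≥0∞} (hq : Measurable q) (hg : Measurable g)
    {k : ℕ} (hqh : ∀ t : ℝ, 0 < t → ∀ x, q (t • x) = t ^ 2 * q x)
    (hgh : ∀ t : ℝ, 0 < t → ∀ x, g (t • x) = ENNReal.ofReal (t ^ k) * g x)
    {t : ℝ} (ht : 0 < t) :
    radialMeasure μ q g (Set.Iio (t ^ 2)) =
      ENNReal.ofReal (t ^ (Module.finrank ℝ E + k)) * radialMeasure μ q g (Set.Iio 1) := by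
  have hI (r : ℝ) : radialMeasure μ q g (Set.Iio r) =
      ∫⁻ x, (Set.Iio r).indicator 1 (q x) * g x ∂μ := by
    rw [← lintegral_radialMeasure μ hq hg (measurable_one.indicator measurableSet_Iio),
      lintegral_indicator_one measurableSet_Iio]
  rw [hI, hI, lintegral_comp_smul_addHaar μ ht, pow_add, ENNReal.ofReal_mul (by positivity),
    mul_assoc, ← lintegral_const_mul' (ENNReal.ofReal (t ^ k)) _ ENNReal.ofReal_ne_top]
  refine congrArg _ (lintegral_congr fun x => ?_)
  rw [hqh t ht, hgh t ht]
  have : (Set.Iio (t ^ 2)).indicator (1 : ℝ → ℝ≥0∞) (t ^ 2 * q x) =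
      (Set.Iio 1).indicator 1 (q x) := by
    have : t ^ 2 * q x < t ^ 2 ↔ q x < 1 := mul_lt_iff_lt_one_right (by positivity)
    simp [Set.indicator_apply, this]
  rw [this]
  ring

/-- Measures on the half-line of the same homogeneity degree are proportional. -/
theorem smul_eq_smul_of_homogeneous_Iio {ν₁ ν₂ : Measure ℝ} {d : ℕ}
    (h₁ : ∀ t : ℝ, 0 < t → ν₁ (Set.Iio (t ^ 2)) = ENNReal.ofReal (t ^ d) * ν₁ (Set.Iio 1))
    (h₂ : ∀ t : ℝ, 0 < t → ν₂ (Set.Iio (t ^ 2)) = ENNReal.ofReal (t ^ d) * ν₂ (Set.Iio 1))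
    (z₁ : ν₁ (Set.Iio 0) = 0) (z₂ : ν₂ (Set.Iio 0) = 0)
    (f₁ : ν₁ (Set.Iio 1) ≠ ∞) (f₂ : ν₂ (Set.Iio 1) ≠ ∞) :
    ν₂ (Set.Iio 1) • ν₁ = ν₁ (Set.Iio 1) • ν₂ := by
  have hle (ν : Measure ℝ) (z : ν (Set.Iio 0) = 0) {r : ℝ} (hr : r ≤ 0) : ν (Set.Iio r) = 0 :=
    measure_mono_null (Set.Iio_subset_Iio hr) z
  have key : ∀ r : ℝ, (ν₂ (Set.Iio 1) • ν₁) (Set.Iio r) = (ν₁ (Set.Iio 1) • ν₂) (Set.Iio r) := by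
    intro r
    simp only [Measure.smul_apply, smul_eq_mul]
    rcases le_or_gt r 0 with hr | hr
    · rw [hle ν₁ z₁ hr, hle ν₂ z₂ hr, mul_zero, mul_zero]
    · have hs : √r ^ 2 = r := Real.sq_sqrt hr.le
      have e₁ := h₁ _ (Real.sqrt_pos.2 hr)
      have e₂ := h₂ _ (Real.sqrt_pos.2 hr)
      rw [hs] at e₁ e₂
      rw [e₁, e₂]
      ring
  refine Measure.ext_of_generateFrom_of_iUnion (Set.range Set.Iio)
    (fun n : ℕ => Set.Iio (((n : ℝ) + 1) ^ 2)) ?_ isPiSystem_Iio ?_ (fun n => ⟨_, rfl⟩) ?_ ?_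
  · rw [← borel_eq_generateFrom_Iio]
    exact BorelSpace.measurable_eq
  · refine Set.eq_univ_of_forall fun x => ?_
    obtain ⟨n, hn⟩ := exists_nat_gt x
    refine Set.mem_iUnion.2 ⟨n, ?_⟩
    have : (0 : ℝ) ≤ n := n.cast_nonneg
    simp only [Set.mem_Iio]
    nlinarith
  · intro n
    rw [Measure.smul_apply, smul_eq_mul, h₁ _ (by positivity)]
    exact ENNReal.mul_ne_top f₂ (ENNReal.mul_ne_top ENNReal.ofReal_ne_top f₁)
  · rintro _ ⟨r, rfl⟩
    exact key r

theorem measure_Iio_one_le_exp_mul (ν : Measure ℝ) :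
    ν (Set.Iio 1) ≤ ENNReal.ofReal (Real.exp 1) * ∫⁻ r, ENNReal.ofReal (Real.exp (-r)) ∂ν := by
  rw [← lintegral_const_mul _ (by fun_prop), ← lintegral_indicator_one measurableSet_Iio]
  refine lintegral_mono fun r => ?_
  by_cases hr : r < 1
  · rw [← ENNReal.ofReal_mul (Real.exp_nonneg _), ← Real.exp_add]
    simp [hr, hr.le]
  · simp [hr]

/-- Two measures on the half-line of the same homogeneity degree integrate every function in the same ratio
as they integrate `exp (-r)`. -/
theorem lintegral_eq_const_mul_of_homogeneous_Iio {ν₁ ν₂ : Measure ℝ} {d : ℕ}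
    (h₁ : ∀ t : ℝ, 0 < t → ν₁ (Set.Iio (t ^ 2)) = ENNReal.ofReal (t ^ d) * ν₁ (Set.Iio 1))
    (h₂ : ∀ t : ℝ, 0 < t → ν₂ (Set.Iio (t ^ 2)) = ENNReal.ofReal (t ^ d) * ν₂ (Set.Iio 1))
    (z₁ : ν₁ (Set.Iio 0) = 0) (z₂ : ν₂ (Set.Iio 0) = 0) {c : ℝ≥0∞}
    (f₂ : ∫⁻ r, ENNReal.ofReal (Real.exp (-r)) ∂ν₂ ≠ ∞)
    (n₂ : ∫⁻ r, ENNReal.ofReal (Real.exp (-r)) ∂ν₂ ≠ 0) (hc : c ≠ ∞)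
    (hexp : ∫⁻ r, ENNReal.ofReal (Real.exp (-r)) ∂ν₁ =
      c * ∫⁻ r, ENNReal.ofReal (Real.exp (-r)) ∂ν₂) (F : ℝ → ℝ≥0∞) :
    ∫⁻ r, F r ∂ν₁ = c * ∫⁻ r, F r ∂ν₂ := by
  have fin (ν : Measure ℝ) (h : ∫⁻ r, ENNReal.ofReal (Real.exp (-r)) ∂ν ≠ ∞) :
      ν (Set.Iio 1) ≠ ∞ :=
    ((measure_Iio_one_le_exp_mul ν).trans_lt
      (ENNReal.mul_lt_top ENNReal.ofReal_lt_top h.lt_top)).ne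
  have g₁ := fin ν₁ (hexp ▸ ENNReal.mul_ne_top hc f₂)
  have g₂ := fin ν₂ f₂
  have hprop := smul_eq_smul_of_homogeneous_Iio h₁ h₂ z₁ z₂ g₁ g₂
  have hI (G : ℝ → ℝ≥0∞) : ν₂ (Set.Iio 1) * ∫⁻ r, G r ∂ν₁ = ν₁ (Set.Iio 1) * ∫⁻ r, G r ∂ν₂ := by
    simpa [lintegral_smul_measure] using congrArg (fun ν => ∫⁻ r, G r ∂ν) hprop
  have hpos : ν₂ (Set.Iio 1) ≠ 0 := by
    intro h0
    have hz : ν₂ = 0 := by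
      rw [← Measure.measure_univ_eq_zero]
      have hU : (Set.univ : Set ℝ) = ⋃ n : ℕ, Set.Iio (((n : ℝ) + 1) ^ 2) := by
        refine (Set.eq_univ_of_forall fun x => ?_).symm
        obtain ⟨n, hn⟩ := exists_nat_gt x
        refine Set.mem_iUnion.2 ⟨n, ?_⟩
        have : (0 : ℝ) ≤ n := n.cast_nonneg
        simp only [Set.mem_Iio]
        nlinarith
      rw [hU, measure_iUnion_null_iff]
      intro n
      rw [h₂ _ (by positivity), h0, mul_zero]
    exact n₂ (by simp [hz])
  have hratio : ν₁ (Set.Iio 1) = c * ν₂ (Set.Iio 1) := by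
    have h := hI fun r => ENNReal.ofReal (Real.exp (-r))
    rw [hexp, ← mul_assoc] at h
    rw [mul_comm c]
    exact ((ENNReal.mul_left_inj n₂ f₂).1 h).symm
  have h := hI F
  rw [hratio, mul_comm c, mul_assoc] at h
  exact (ENNReal.mul_right_inj hpos g₂).1 h

/-- The Householder reflection sending `b` to the first coordinate axis. -/
theorem exists_orthogonal_mulVec_eq_single {k : ℕ} (b : Fin (k + 1) → ℝ) :
    ∃ Q : Matrix (Fin (k + 1)) (Fin (k + 1)) ℝ, Qᵀ * Q = 1 ∧
      Q *ᵥ b = Pi.single 0 √(∑ i, b i ^ 2) := by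
  set r := √(∑ i, b i ^ 2) with hr
  set w := b - Pi.single 0 r with hw
  by_cases h0 : w = 0
  · exact ⟨1, by simp, by simpa using sub_eq_zero.1 h0⟩
  have hs : w ⬝ᵥ w ≠ 0 := fun h => h0 (dotProduct_self_eq_zero.1 h)
  have hbb : b ⬝ᵥ b = r ^ 2 := by
    rw [hr, Real.sq_sqrt (Finset.sum_nonneg fun i _ => sq_nonneg _)]
    simp [dotProduct, sq]
  have hwb : w ⬝ᵥ b = r ^ 2 - r * b 0 := by
    simp [hw, sub_dotProduct, hbb]
  have hww : w ⬝ᵥ w = 2 * (w ⬝ᵥ b) := by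
    rw [hwb]
    simp [hw, sub_dotProduct, dotProduct_sub, hbb]
    ring
  refine ⟨1 - (2 / (w ⬝ᵥ w)) • vecMulVec w w, ?_, ?_⟩
  · have ht : (vecMulVec w w)ᵀ = vecMulVec w w := transpose_vecMulVec w w
    have hsq : vecMulVec w w * vecMulVec w w = (w ⬝ᵥ w) • vecMulVec w w := by
      rw [vecMulVec_mul_vecMulVec]
      ext i j
      simp [vecMulVec_apply]
      ring
    rw [transpose_sub, transpose_smul, ht, transpose_one, sub_mul, mul_sub, mul_sub,
      smul_mul_smul_comm, hsq, smul_smul]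
    simp only [one_mul, mul_one]
    have : 2 / (w ⬝ᵥ w) * (2 / (w ⬝ᵥ w)) * (w ⬝ᵥ w) = 2 / (w ⬝ᵥ w) + 2 / (w ⬝ᵥ w) := by
      field_simp
      norm_num
    rw [this, add_smul]
    abel
  · have h2 : vecMulVec w w *ᵥ b = (w ⬝ᵥ b) • w := by
      ext i
      simp [vecMulVec_mulVec, mul_comm]
    have h1 : 2 / (w ⬝ᵥ w) * (w ⬝ᵥ b) = 1 := by
      rw [← mul_div_right_comm, ← hww, div_self hs]
    rw [sub_mulVec, one_mulVec, smul_mulVec, h2, smul_smul, h1, one_smul, hw, sub_sub_cancel]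

theorem sum_sq_mulVec_of_orthogonal {k : ℕ} {Q : Matrix (Fin k) (Fin k) ℝ} (hQ : Qᵀ * Q = 1)
    (v : Fin k → ℝ) : ∑ j, (Q *ᵥ v) j ^ 2 = ∑ j, v j ^ 2 := by
  have h : (Q *ᵥ v) ⬝ᵥ (Q *ᵥ v) = v ⬝ᵥ v := by
    rw [dotProduct_mulVec, ← mulVec_transpose, mulVec_mulVec, hQ, one_mulVec]
  simpa [dotProduct, sq] using h

theorem abs_det_of_orthogonal {k : ℕ} {Q : Matrix (Fin k) (Fin k) ℝ} (hQ : Qᵀ * Q = 1) :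
    |Q.det| = 1 := by
  have h := congrArg det hQ
  rw [det_mul, det_transpose, det_one] at h
  nlinarith [abs_mul_abs_self Q.det, abs_nonneg Q.det]

theorem volume_preserving_mulVec_of_orthogonal {k : ℕ} {Q : Matrix (Fin k) (Fin k) ℝ}
    (hQ : Qᵀ * Q = 1) : MeasurePreserving (fun v : Fin k → ℝ => Q *ᵥ v) := by
  have habs := abs_det_of_orthogonal hQ
  have hdet : Q.det ≠ 0 := by
    intro h
    simp [h] at habs
  refine ⟨by fun_prop, ?_⟩
  have h := Real.map_matrix_volume_pi_eq_smul_volume_pi hdet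
  rw [abs_inv, habs, inv_one, ENNReal.ofReal_one, one_smul] at h
  exact h

theorem lintegral_gaussian_det_cons {k : ℕ} (b : Fin (k + 1) → ℝ) :
    ∫⁻ B : Fin k → Fin (k + 1) → ℝ, ENNReal.ofReal (Real.exp (-∑ i, ∑ j, B i j ^ 2)) *
        ENNReal.ofReal |det (of (Fin.cons b B : Fin (k + 1) → Fin (k + 1) → ℝ))| =
      ENNReal.ofReal √(∑ i, b i ^ 2) * (ENNReal.ofReal (π ^ ((k : ℝ) / 2)) *
        ∫⁻ B : Fin k → Fin k → ℝ, ENNReal.ofReal (Real.exp (-∑ i, ∑ j, B i j ^ 2)) *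
          ENNReal.ofReal |det (of B)|) := by
  obtain ⟨Q, hQ, hb⟩ := exists_orthogonal_mulVec_eq_single b
  set r := √(∑ i, b i ^ 2) with hr
  have hr0 : 0 ≤ r := Real.sqrt_nonneg _
  have hdet (B : Fin k → Fin (k + 1) → ℝ) :
      |det (of (Fin.cons b B : Fin (k + 1) → Fin (k + 1) → ℝ))| =
        r * |det (of fun i j => (Q *ᵥ B i) (Fin.succAbove 0 j))| := by
    have hmul : of (Fin.cons b B : Fin (k + 1) → Fin (k + 1) → ℝ) * Qᵀ =
        of (Fin.cons (Pi.single 0 r) fun i => Q *ᵥ B i : Fin (k + 1) → Fin (k + 1) → ℝ) := by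
      ext i j
      have (v : Fin (k + 1) → ℝ) : ∑ l, v l * Q j l = (Q *ᵥ v) j := by
        simp [mulVec, dotProduct, mul_comm]
      refine Fin.cases ?_ (fun i => ?_) i
      · simp [mul_apply, this, hb]
      · simp [mul_apply, this]
    have h := congrArg (fun M => |det M|) hmul
    simp only [det_mul, det_transpose, abs_mul, abs_det_of_orthogonal hQ, mul_one] at h
    rw [h, det_succ_row_zero, Finset.sum_eq_single 0]
    · simp [abs_mul, abs_of_nonneg hr0, submatrix]
    · intro j _ hj
      simp [hj]
    · simp
  have hmeas : Measurable fun B : Fin k → Fin k → ℝ => ENNReal.ofReal |det (of B)| := by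
    simp only [det_apply, of_apply]
    fun_prop
  rw [← lintegral_gaussian_mul_of_removeColumn k k 0 _ hmeas,
    ← lintegral_const_mul' _ _ ENNReal.ofReal_ne_top,
    ← (volume_preserving_pi fun _ : Fin k =>
      volume_preserving_mulVec_of_orthogonal hQ).lintegral_comp
        (f := fun A : Fin k → Fin (k + 1) → ℝ => ENNReal.ofReal r *
          (ENNReal.ofReal (Real.exp (-∑ i, ∑ j, A i j ^ 2)) *
            ENNReal.ofReal |det (of fun i j => A i (Fin.succAbove 0 j))|))]
  · refine lintegral_congr fun B => ?_
    simp only [hdet, sum_sq_mulVec_of_orthogonal hQ]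
    rw [ENNReal.ofReal_mul hr0]
    ring
  · have := hmeas.comp (f := fun A : Fin k → Fin (k + 1) → ℝ =>
      fun i j => A i (Fin.succAbove 0 j)) (by fun_prop)
    exact Measurable.const_mul (Measurable.mul (by fun_prop) this) _

theorem lintegral_gaussian_det (m : ℕ) :
    ∫⁻ B : Fin m → Fin m → ℝ, ENNReal.ofReal (Real.exp (-∑ i, ∑ j, B i j ^ 2)) *
        ENNReal.ofReal |det (of B)| =
      ENNReal.ofReal (π ^ ((m : ℝ) / 2)) ^ m *
        ENNReal.ofReal (Real.Gamma ((m + 1 : ℝ) / 2) / √π) := by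
  induction m with
  | zero =>
    have : √π ≠ 0 := (Real.sqrt_pos.2 Real.pi_pos).ne'
    have hG : Real.Gamma (((0 : ℕ) + 1 : ℝ) / 2) / √π = 1 := by
      rw [Nat.cast_zero, zero_add, Real.Gamma_one_half_eq, div_self this]
    rw [hG]
    simp [volume_pi]
  | succ k ih =>
    have hmeas : Measurable fun p : (Fin (k + 1) → ℝ) × (Fin k → Fin (k + 1) → ℝ) =>
        ENNReal.ofReal (Real.exp (-∑ i, p.1 i ^ 2)) *
          (ENNReal.ofReal (Real.exp (-∑ i, ∑ j, p.2 i j ^ 2)) *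
          ENNReal.ofReal |det (of (Fin.cons p.1 p.2 : Fin (k + 1) → Fin (k + 1) → ℝ))|) := by
      have : Measurable fun p : (Fin (k + 1) → ℝ) × (Fin k → Fin (k + 1) → ℝ) =>
          det (of (Fin.cons p.1 p.2 : Fin (k + 1) → Fin (k + 1) → ℝ)) := by
        have he (i j) : Measurable fun p : (Fin (k + 1) → ℝ) × (Fin k → Fin (k + 1) → ℝ) =>
            (Fin.cons p.1 p.2 : Fin (k + 1) → Fin (k + 1) → ℝ) i j := by
          refine Fin.cases ?_ (fun i => ?_) i
          · simp only [Fin.cons_zero]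
            fun_prop
          · simp only [Fin.cons_succ]
            fun_prop
        simp only [det_apply, of_apply]
        fun_prop
      fun_prop
    have hsplit := (volume_preserving_piFinSuccAbove
      (fun _ : Fin (k + 1) => Fin (k + 1) → ℝ) 0).lintegral_comp hmeas
    have hcons (A : Fin (k + 1) → Fin (k + 1) → ℝ) :
        (Fin.cons (A 0) (fun i => A (Fin.succ i)) : Fin (k + 1) → Fin (k + 1) → ℝ) = A :=
      Fin.cons_self_tail A
    have hlhs : ∫⁻ B : Fin (k + 1) → Fin (k + 1) → ℝ,
        ENNReal.ofReal (Real.exp (-∑ i, ∑ j, B i j ^ 2)) * ENNReal.ofReal |det (of B)| =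
        ∫⁻ p : (Fin (k + 1) → ℝ) × (Fin k → Fin (k + 1) → ℝ),
        ENNReal.ofReal (Real.exp (-∑ i, p.1 i ^ 2)) *
          (ENNReal.ofReal (Real.exp (-∑ i, ∑ j, p.2 i j ^ 2)) *
          ENNReal.ofReal |det (of (Fin.cons p.1 p.2 : Fin (k + 1) → Fin (k + 1) → ℝ))|) := by
      rw [← hsplit]
      refine lintegral_congr fun A => ?_
      have h1 : (MeasurableEquiv.piFinSuccAbove (fun _ : Fin (k + 1) => Fin (k + 1) → ℝ) 0 A) =
          (A 0, fun i => A (Fin.succ i)) := rfl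
      rw [h1]
      simp only [hcons]
      rw [← mul_assoc, ← ENNReal.ofReal_mul (Real.exp_nonneg (-∑ i, A 0 i ^ 2)),
        ← Real.exp_add, Fin.sum_univ_succ (n := k), neg_add]
    rw [hlhs, Measure.volume_eq_prod, lintegral_prod _ hmeas.aemeasurable]
    simp only [lintegral_const_mul' _ _ ENNReal.ofReal_ne_top, lintegral_gaussian_det_cons, ih]
    have hb : ∫⁻ b : Fin (k + 1) → ℝ, ENNReal.ofReal (Real.exp (-∑ i, b i ^ 2)) *
        ENNReal.ofReal √(∑ i, b i ^ 2) =
        ENNReal.ofReal (π ^ ((k + 1 : ℝ) / 2) * Real.Gamma ((k + 1 + (1 : ℕ) : ℝ) / 2) /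
          Real.Gamma ((k + 1 : ℝ) / 2)) := by
      rw [← lintegral_norm_pow_mul_exp_neg_sq k 1]
      refine lintegral_congr fun b => ?_
      rw [← ENNReal.ofReal_mul (Real.exp_nonneg _), pow_one, mul_comm]
    simp only [← mul_assoc (ENNReal.ofReal (Real.exp _)) (ENNReal.ofReal √_)]
    rw [lintegral_mul_const _ (by fun_prop), hb]
    have hG : 0 < Real.Gamma ((k + 1 : ℝ) / 2) := Real.Gamma_pos_of_pos (by positivity)
    have hG' : 0 < Real.Gamma ((k + 1 + 1 : ℝ) / 2) := Real.Gamma_pos_of_pos (by positivity)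
    have hs : π ^ ((k + 1 : ℝ) / 2) = π ^ ((k : ℝ) / 2) * √π := by
      rw [Real.sqrt_eq_rpow, ← Real.rpow_add Real.pi_pos, add_div]
    have hs' : √π ^ (k + 1) = π ^ ((k + 1 : ℝ) / 2) := by
      rw [Real.sqrt_eq_rpow, ← Real.rpow_natCast, ← Real.rpow_mul Real.pi_pos.le]
      congr 1
      push_cast
      ring
    rw [← mul_assoc (ENNReal.ofReal (π ^ ((k : ℝ) / 2))), ← pow_succ',
      ← ENNReal.ofReal_pow (by positivity), ← ENNReal.ofReal_pow (by positivity),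
      ← ENNReal.ofReal_mul (by positivity), ← ENNReal.ofReal_mul (by positivity),
      ← ENNReal.ofReal_mul (by positivity)]
    congr 1
    push_cast
    have hs2 : (π ^ ((k + 1 : ℝ) / 2)) ^ (k + 1) =
        (π ^ ((k : ℝ) / 2)) ^ (k + 1) * π ^ ((k + 1 : ℝ) / 2) := by
      rw [← hs', hs', hs, mul_pow, hs', hs]
    rw [hs2]
    field_simp

theorem lintegral_gaussian_det_castAdd (m n : ℕ) :
    ∫⁻ A : Fin m → Fin (m + n) → ℝ, ENNReal.ofReal (Real.exp (-∑ i, ∑ j, A i j ^ 2)) *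
        ENNReal.ofReal |det ((of A).submatrix id (Fin.castAdd n))| =
      ENNReal.ofReal (π ^ ((m : ℝ) / 2)) ^ (m + n) *
        ENNReal.ofReal (Real.Gamma ((m + 1 : ℝ) / 2) / √π) := by
  induction n with
  | zero => exact lintegral_gaussian_det m
  | succ n ih =>
    have hmeas : Measurable fun A : Fin m → Fin (m + n) → ℝ =>
        ENNReal.ofReal |det ((of A).submatrix id (Fin.castAdd n))| := by
      simp only [det_apply, submatrix_apply, of_apply]
      fun_prop
    have h := lintegral_gaussian_mul_of_removeColumn m (m + n) (Fin.last _) _ hmeas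
    rw [ih, ← mul_assoc, ← pow_succ'] at h
    refine Eq.trans ?_ h
    refine lintegral_congr fun A => ?_
    have hsub : (of A).submatrix id (Fin.castAdd (n + 1)) =
        (of fun i j => A i ((Fin.last (m + n)).succAbove j)).submatrix id (Fin.castAdd n) := by
      ext i j
      simp only [submatrix_apply, of_apply, Fin.succAbove_last]
      rfl
    rw [hsub]
    rfl

/-- If `(A, b) ↦ f(tr Aᵀ A + bᵀ b)` is a probability density, then
`∫ f(tr Aᵀ A) |det B| dA = Γ((m+1)/2)/π^((m+1)/2)`, independently of `f`. -/
theorem C_value_girko (m n : ℕ) (hm : 1 ≤ m) (hn : 1 ≤ n)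
    (f : ℝ → ℝ) (hf_meas : Measurable f) (hf_nonneg : ∀ x, 0 ≤ f x)
    (hprob : IsProbabilityMeasure
      (volume.withDensity fun p : (Fin m → Fin (m + n) → ℝ) × (Fin m → ℝ) =>
        ENNReal.ofReal
          (f (Matrix.trace ((Matrix.of p.1)ᵀ * Matrix.of p.1) + ∑ i, p.2 i ^ 2)))) :
    (∫⁻ A : Fin m → Fin (m + n) → ℝ,
        ENNReal.ofReal (f (Matrix.trace ((Matrix.of A)ᵀ * Matrix.of A)) *
          |Matrix.det ((Matrix.of A).submatrix id (Fin.castAdd n))|))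
      = ENNReal.ofReal (Real.Gamma ((m + 1 : ℝ) / 2) / Real.pi ^ ((m + 1 : ℝ) / 2)) := by
  have htr (A : Fin m → Fin (m + n) → ℝ) : trace ((of A)ᵀ * of A) = ∑ i, ∑ j, A i j ^ 2 := by
    simp only [trace, diag_apply, mul_apply, transpose_apply, of_apply, ← sq]
    exact Finset.sum_comm
  simp only [htr] at hprob ⊢
  set q₁ : (Fin m → Fin (m + n) → ℝ) → ℝ := fun A => ∑ i, ∑ j, A i j ^ 2 with hq₁
  set q₂ : (Fin m → Fin (m + n) → ℝ) × (Fin m → ℝ) → ℝ :=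
    fun p => (∑ i, ∑ j, p.1 i j ^ 2) + ∑ i, p.2 i ^ 2 with hq₂
  set g₁ : (Fin m → Fin (m + n) → ℝ) → ℝ≥0∞ :=
    fun A => ENNReal.ofReal |det ((of A).submatrix id (Fin.castAdd n))| with hg₁
  have mq₁ : Measurable q₁ := by fun_prop
  have mq₂ : Measurable q₂ := by fun_prop
  have mg₁ : Measurable g₁ := by
    simp only [hg₁, det_apply, submatrix_apply, of_apply]
    fun_prop
  have zero {E : Type} [MeasurableSpace E] (μ : Measure E) {q : E → ℝ} {g : E → ℝ≥0∞}
      (mq : Measurable q) (h : ∀ x, 0 ≤ q x) : radialMeasure μ q g (Set.Iio 0) = 0 := by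
    rw [radialMeasure, Measure.map_apply mq measurableSet_Iio]
    have : q ⁻¹' Set.Iio 0 = ∅ := Set.eq_empty_of_forall_notMem fun x hx => (h x).not_gt hx
    simp [this]
  have h₁ (t : ℝ) (ht : 0 < t) : radialMeasure volume q₁ g₁ (Set.Iio (t ^ 2)) =
      ENNReal.ofReal (t ^ (Module.finrank ℝ (Fin m → Fin (m + n) → ℝ) + m)) * radialMeasure volume q₁ g₁ (Set.Iio 1) := by
    have h := radialMeasure_Iio volume mq₁ mg₁ (k := m) (fun t _ A => by
      simp [hq₁, mul_pow, Finset.mul_sum]) (fun t ht A => by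
      have : (of (t • A)).submatrix id (Fin.castAdd n) =
          t • (of A).submatrix id (Fin.castAdd n) := rfl
      simp only [hg₁]
      rw [this, det_smul, abs_mul, abs_of_pos (by positivity), ENNReal.ofReal_mul (by positivity),
        Fintype.card_fin]) ht
    simpa using h
  have h₂ (t : ℝ) (ht : 0 < t) : radialMeasure volume q₂ 1 (Set.Iio (t ^ 2)) =
      ENNReal.ofReal (t ^ (Module.finrank ℝ (Fin m → Fin (m + n) → ℝ) + m)) * radialMeasure volume q₂ 1 (Set.Iio 1) := by
    have : (volume : Measure (Fin m → Fin (m + n) → ℝ)).IsAddHaarMeasure :=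
      Measure.pi.isAddHaarMeasure fun _ => (volume : Measure (Fin (m + n) → ℝ))
    have : (volume : Measure ((Fin m → Fin (m + n) → ℝ) × (Fin m → ℝ))).IsAddHaarMeasure :=
      Measure.prod.instIsAddHaarMeasure _ _
    have h := radialMeasure_Iio volume mq₂ measurable_one (k := 0) (fun t _ A => by
      simp [hq₂, mul_pow, Finset.mul_sum, mul_add]) (fun t ht A => by simp) ht
    simpa using h
  have e₁ : ∫⁻ r, ENNReal.ofReal (Real.exp (-r)) ∂(radialMeasure volume q₁ g₁) =
      ENNReal.ofReal (π ^ ((m : ℝ) / 2)) ^ (m + n) *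
        ENNReal.ofReal (Real.Gamma ((m + 1 : ℝ) / 2) / √π) := by
    rw [lintegral_radialMeasure _ mq₁ mg₁ (by fun_prop)]
    exact lintegral_gaussian_det_castAdd m n
  have e₂ : ∫⁻ r, ENNReal.ofReal (Real.exp (-r)) ∂(radialMeasure volume q₂ 1) =
      ENNReal.ofReal (π ^ ((m : ℝ) / 2)) ^ (m + n) * ENNReal.ofReal (π ^ ((m : ℝ) / 2)) := by
    rw [lintegral_radialMeasure _ mq₂ measurable_one (by fun_prop),
      ← lintegral_gaussian_matrix m (m + n), ← lintegral_exp_neg_sum_sq m,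
      ← lintegral_prod_mul (Measurable.aemeasurable (by fun_prop))
        (Measurable.aemeasurable (by fun_prop)), Measure.volume_eq_prod]
    refine lintegral_congr fun p => ?_
    rw [← ENNReal.ofReal_mul (Real.exp_nonneg _), ← Real.exp_add, ← neg_add]
    simp [hq₂]
  have hP : 0 < π ^ ((m : ℝ) / 2) := by positivity
  have hP0 : ENNReal.ofReal (π ^ ((m : ℝ) / 2)) ≠ 0 := by simpa using hP
  have hG : 0 < Real.Gamma ((m + 1 : ℝ) / 2) := Real.Gamma_pos_of_pos (by positivity)
  have key := lintegral_eq_const_mul_of_homogeneous_Iio h₁ h₂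
    (zero volume mq₁ fun A => by positivity) (zero volume mq₂ fun A => by positivity)
    (c := ENNReal.ofReal (Real.Gamma ((m + 1 : ℝ) / 2) / π ^ ((m + 1 : ℝ) / 2)))
    (by rw [e₂]; finiteness) (by rw [e₂]; exact mul_ne_zero (pow_ne_zero _ hP0) hP0)
    ENNReal.ofReal_ne_top (by
      rw [e₁, e₂, mul_left_comm, ← ENNReal.ofReal_mul (by positivity), add_div,
        Real.rpow_add Real.pi_pos, ← Real.sqrt_eq_rpow]
      congr 2
      field_simp) fun r => ENNReal.ofReal (f r)
  rw [lintegral_radialMeasure _ mq₁ mg₁ (by fun_prop),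
    lintegral_radialMeasure _ mq₂ measurable_one (by fun_prop)] at key
  have hone : ∫⁻ p, ENNReal.ofReal (f (q₂ p)) * (1 : (Fin m → Fin (m + n) → ℝ) × (Fin m → ℝ) → ℝ≥0∞) p = 1 := by
    have h := hprob.measure_univ
    rw [withDensity_apply _ MeasurableSet.univ, Measure.restrict_univ] at h
    simpa using h
  rw [hone, mul_one] at key
  rw [← key]
  exact lintegral_congr fun A => ENNReal.ofReal_mul (hf_nonneg _)
end

section
/- Let m ≥ 1 and n ≥ 1 be integers and σ > 0. Let the entries A_{iα} (1 ≤ i ≤ m, 1 ≤ α ≤ m+n) of a real m×(m+n) random matrix A and the entries b_i of a random vector b ∈ ℝ^m be independent, each Gaussian with mean 0 and variance σ². Write A = (B, X) with B the first m columns and X the remaining n columns. Fix u ∈ ℝⁿ and set β = √(1 + ∑_{p=1}^{n} u_p²). Then for each index i, the i-th component z_i of the random vector z = B⁻¹(b − Xu) is distributed on ℝ with density ζ ↦ β/(π(β² + ζ²)), i.e., a Cauchy distribution of width β (independent of σ and of i). -/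
open MeasureTheory Matrix ProbabilityTheory
open scoped ENNReal Real NNReal

theorem map_sum_mul_pi_gaussianReal {ι : Type*} [Fintype ι] (c : ι → ℝ) (v : ℝ≥0) :
    (Measure.pi fun _ : ι => gaussianReal 0 v).map (fun x => ∑ k, c k * x k) =
      gaussianReal 0 ((∑ k, c k ^ 2).toNNReal * v) := by
  have hm : Measurable fun x : ι → ℝ => ∑ k, c k * x k := by fun_prop
  have : IsProbabilityMeasure ((Measure.pi fun _ : ι => gaussianReal 0 v).map
      (fun x => ∑ k, c k * x k)) := Measure.isProbabilityMeasure_map hm.aemeasurable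
  refine Measure.ext_of_charFun (funext fun t => ?_)
  have hc : 0 ≤ ∑ k, c k ^ 2 := Finset.sum_nonneg fun k _ => sq_nonneg _
  have hk (k : ι) : ∫ y, Complex.exp (t * (c k * y) * Complex.I) ∂gaussianReal 0 v =
      Complex.exp (-(c k ^ 2 * v * t ^ 2 / 2)) := by
    have := charFun_gaussianReal (μ := 0) (v := v) (t * c k)
    rw [charFun_apply_real] at this
    push_cast at this
    simp_rw [← mul_assoc]
    rw [this]
    congr 1
    ring
  rw [charFun_apply_real, integral_map hm.aemeasurable (by fun_prop), charFun_gaussianReal]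
  have (x : ι → ℝ) : Complex.exp (t * (∑ k, c k * x k : ℝ) * Complex.I) =
      ∏ k, Complex.exp (t * (c k * x k) * Complex.I) := by
    rw [← Complex.exp_sum]
    push_cast
    rw [Finset.mul_sum, Finset.sum_mul]
  simp_rw [this]
  rw [integral_fintype_prod_eq_prod
    (f := fun k (y : ℝ) => Complex.exp (t * (c k * y) * Complex.I))]
  simp_rw [hk]
  rw [← Complex.exp_sum, NNReal.coe_mul, Real.coe_toNNReal _ hc]
  congr 1
  push_cast
  rw [Finset.sum_neg_distrib, ← Finset.sum_div, ← Finset.sum_mul, ← Finset.sum_mul]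
  ring

theorem lintegral_abs_mul_exp_neg_mul_sq {b : ℝ} (hb : 0 < b) :
    ∫⁻ x : ℝ, ENNReal.ofReal (|x| * Real.exp (-b * x ^ 2)) = ENNReal.ofReal b⁻¹ := by
  have hint : Integrable fun x : ℝ => |x| * Real.exp (-b * x ^ 2) := by
    refine (integrable_mul_exp_neg_mul_sq hb).norm.congr (ae_of_all _ fun x => ?_)
    simp
  rw [← ofReal_integral_eq_lintegral_ofReal hint (ae_of_all _ fun x => by positivity)]
  congr 1
  have h := integral_comp_abs (f := fun x : ℝ => x * Real.exp (-b * x ^ 2))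
  simp only [sq_abs] at h
  rw [h]
  have h2 := integral_rpow_mul_exp_neg_mul_rpow (p := 2) (q := 1) (by norm_num) (by norm_num) hb
  norm_num [Real.rpow_neg_one] at h2
  norm_num [h2]
  field_simp

theorem gaussianReal_prod_map_div {v w : ℝ≥0} (hv : v ≠ 0) {β : ℝ} (hβ : 0 < β)
    (hw : (w : ℝ) = β ^ 2 * v) :
    ((gaussianReal 0 v).prod (gaussianReal 0 w)).map (fun p => p.2 / p.1) =
      volume.withDensity fun ζ : ℝ => ENNReal.ofReal (β / (Real.pi * (β ^ 2 + ζ ^ 2))) := by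
  have hv' : (0 : ℝ) < v := by positivity
  have hw' : (0 : ℝ) < w := hw ▸ by positivity
  have hw0 : w ≠ 0 := by exact_mod_cast hw'.ne'
  let f : ℝ → ℝ → ℝ := fun x ζ =>
    (2 * π * β * v)⁻¹ * (|x| * Real.exp (-((2 * (v : ℝ))⁻¹ * (1 + ζ ^ 2 / β ^ 2)) * x ^ 2))
  have hdens (x : ℝ) (hx : x ≠ 0) (ζ : ℝ) :
      gaussianPDF 0 v x * gaussianPDF 0 (w / .mk (x ^ 2) (sq_nonneg x)) ζ = ENNReal.ofReal (f x ζ) := by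
    rw [gaussianPDF, gaussianPDF, ← ENNReal.ofReal_mul (gaussianPDFReal_nonneg _ _ _)]
    congr 1
    have h1 : √(2 * π * v) * √(2 * π * (w / x ^ 2)) = 2 * π * β * v / |x| := by
      rw [← Real.sqrt_mul (by positivity), hw,
        show 2 * π * v * (2 * π * (β ^ 2 * v / x ^ 2)) = (2 * π * β * v / |x|) ^ 2 by
          rw [div_pow, sq_abs]; ring, Real.sqrt_sq (by positivity)]
    simp only [gaussianPDFReal, f, NNReal.coe_div, NNReal.coe_mk]
    rw [mul_mul_mul_comm, ← mul_inv, h1, ← Real.exp_add, inv_div, div_eq_inv_mul, mul_assoc]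
    congr 3
    rw [hw]
    field_simp
    ring
  ext S hS
  have hm : Measurable fun p : ℝ × ℝ => p.2 / p.1 := by fun_prop
  have hf : Measurable (Function.uncurry fun x ζ => ENNReal.ofReal (f x ζ)) := by
    simp only [f, Function.uncurry_def]
    fun_prop
  rw [Measure.map_apply hm hS, Measure.prod_apply (hm hS), withDensity_apply _ hS,
    gaussianReal_of_var_ne_zero 0 hv,
    lintegral_withDensity_eq_lintegral_mul _ (measurable_gaussianPDF _ _)
      (measurable_measure_prodMk_left (hm hS))]
  calc _ = ∫⁻ x, ∫⁻ ζ in S, ENNReal.ofReal (f x ζ) := by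
        refine lintegral_congr_ae ?_
        filter_upwards [Measure.ae_ne volume (0 : ℝ)] with x hx
        simp_rw [← hdens x hx]
        rw [lintegral_const_mul _ (measurable_gaussianPDF _ _), Pi.mul_apply]
        congr 1
        have hne : w / .mk (x ^ 2) (sq_nonneg x) ≠ 0 :=
          div_ne_zero hw0 fun h => hx (by simpa using congrArg NNReal.toReal h)
        have := gaussianReal_map_div_const (μ := 0) (v := w) x
        rw [zero_div] at this
        rw [← gaussianReal_apply _ hne, ← this, Measure.map_apply (by fun_prop) hS]
        rfl
    _ = ∫⁻ ζ in S, ∫⁻ x, ENNReal.ofReal (f x ζ) := lintegral_lintegral_swap hf.aemeasurable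
    _ = _ := by
        refine lintegral_congr fun ζ => ?_
        simp only [f]
        simp_rw [ENNReal.ofReal_mul (show 0 ≤ (2 * π * β * v)⁻¹ by positivity)]
        rw [lintegral_const_mul _ (by fun_prop), lintegral_abs_mul_exp_neg_mul_sq (by positivity),
          ← ENNReal.ofReal_mul (by positivity)]
        congr 1
        field_simp

theorem absolutelyContinuous_pi_fin {n : ℕ} {α : Type*} [MeasurableSpace α]
    {μ ν : Measure α} [SigmaFinite μ] [SigmaFinite ν] (h : μ ≪ ν) :
    (Measure.pi fun _ : Fin n => μ) ≪ (Measure.pi fun _ : Fin n => ν) := by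
  induction n with
  | zero => rw [Measure.pi_of_empty, Measure.pi_of_empty]
  | succ n ih =>
    have hμ := (measurePreserving_piFinSuccAbove (fun _ : Fin (n + 1) => μ) 0).symm
    have hν := (measurePreserving_piFinSuccAbove (fun _ : Fin (n + 1) => ν) 0).symm
    rw [← hμ.map_eq, ← hν.map_eq]
    exact (h.prod ih).map hμ.measurable

theorem ae_det_submatrix_succ_ne_zero {n : ℕ} {v : ℝ≥0} (hv : v ≠ 0) :
    ∀ᵐ W : Fin (n + 1) → Fin n → ℝ ∂(Measure.pi fun _ => Measure.pi fun _ => gaussianReal 0 v),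
      ((Matrix.of W).submatrix Fin.succ id).det ≠ 0 := by
  have hac : (Measure.pi fun _ : Fin (n + 1) => Measure.pi fun _ : Fin n => gaussianReal 0 v) ≪
      (volume : Measure (Fin (n + 1) → Fin n → ℝ)) :=
    absolutelyContinuous_pi_fin <| absolutelyContinuous_pi_fin <|
      gaussianReal_absolutelyContinuous 0 hv
  refine hac.ae_le ?_
  let J : Fin (n + 1) → Fin n → ℝ := fun k l => if k = l.succ then 1 else 0
  let L : ℝ →ₗ[ℝ] (Fin (n + 1) → Fin n → ℝ) := LinearMap.toSpanSingleton ℝ _ J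
  have hcont : Continuous fun W : Fin (n + 1) → Fin n → ℝ =>
      ((Matrix.of W).submatrix Fin.succ id).det := by
    refine Continuous.matrix_det (continuous_pi fun k => continuous_pi fun l => ?_)
    simp only [submatrix_apply, of_apply]
    fun_prop
  refine ae_mem_of_ae_add_linearMap_mem L volume volume
    (s := {W | ((Matrix.of W).submatrix Fin.succ id).det ≠ 0})
    (hcont.measurable (measurableSet_singleton (0 : ℝ)).compl) fun W => ?_
  set M := (Matrix.of W).submatrix Fin.succ id with hM
  have key (t : ℝ) : ((Matrix.of (W + L t)).submatrix Fin.succ id).det = (-M).charpoly.eval t := by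
    rw [Matrix.eval_charpoly]
    congr 1
    ext k l
    simp [L, J, hM, Matrix.scalar_apply, Matrix.diagonal_apply, add_comm]
  have hfin : {t : ℝ | (-M).charpoly.eval t = 0}.Finite :=
    Polynomial.finite_setOfPred_isRoot (Matrix.charpoly_monic _).ne_zero
  filter_upwards [hfin.countable.ae_notMem volume] with t ht
  simpa only [Set.mem_ofPred_eq, key] using ht

theorem measurePreserving_fin_append_split {α : Type*} [MeasurableSpace α] (m n : ℕ)
    (ν : Measure α) [SigmaFinite ν] :
    MeasurePreserving
      (fun a : Fin (m + n) → α => (fun j => a (Fin.castAdd n j), fun j => a (Fin.natAdd m j)))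
      (Measure.pi fun _ => ν) ((Measure.pi fun _ => ν).prod (Measure.pi fun _ => ν)) :=
  (measurePreserving_sumPiEquivProdPi (X := fun _ : Fin m ⊕ Fin n => α) fun _ => ν).comp
    (measurePreserving_piCongrLeft (α := fun _ => α) (fun _ => ν) finSumFinEquiv).symm

theorem measurePreserving_sub_sum_mul_gaussianReal {ι : Type*} [Fintype ι] (v : ℝ≥0) (u : ι → ℝ) :
    MeasurePreserving (fun p : (ι → ℝ) × ℝ => p.2 - ∑ q, p.1 q * u q)
      ((Measure.pi fun _ => gaussianReal 0 v).prod (gaussianReal 0 v))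
      (gaussianReal 0 ((1 + ∑ q, u q ^ 2).toNNReal * v)) := by
  have hm : Measurable fun x : ι → ℝ => ∑ q, -u q * x q := by fun_prop
  refine ⟨by fun_prop, ?_⟩
  have hcomp : (fun p : (ι → ℝ) × ℝ => p.2 - ∑ q, p.1 q * u q) =
      (fun p : ℝ × ℝ => p.1 + p.2) ∘ Prod.map (fun x : ι → ℝ => ∑ q, -u q * x q) id := by
    ext p
    simp [Finset.sum_neg_distrib, mul_comm, sub_eq_neg_add]
  rw [hcomp, ← Measure.map_map (by fun_prop) (by fun_prop),
    ← Measure.map_prod_map _ _ hm measurable_id, Measure.map_id, map_sum_mul_pi_gaussianReal]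
  refine gaussianReal_conv_gaussianReal.trans ?_
  rw [add_zero, Real.toNNReal_add zero_le_one (Finset.sum_nonneg fun q _ => sq_nonneg _)]
  simp only [neg_sq, Real.toNNReal_one]
  ring_nf

theorem measurePreserving_gaussian_row {m n : ℕ} (v : ℝ≥0) (u : Fin n → ℝ) (i : Fin (m + 1)) :
    MeasurePreserving
      (fun p : (Fin (m + 1 + n) → ℝ) × ℝ =>
        ((p.1 (Fin.castAdd n i), fun j => p.1 (Fin.castAdd n (i.succAbove j))),
          p.2 - ∑ q, p.1 (Fin.natAdd (m + 1) q) * u q))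
      ((Measure.pi fun _ => gaussianReal 0 v).prod (gaussianReal 0 v))
      (((gaussianReal 0 v).prod (Measure.pi fun _ : Fin m => gaussianReal 0 v)).prod
        (gaussianReal 0 ((1 + ∑ q, u q ^ 2).toNNReal * v))) :=
  ((measurePreserving_piFinSuccAbove (fun _ : Fin (m + 1) => gaussianReal 0 v) i).prod
    (measurePreserving_sub_sum_mul_gaussianReal v u)).comp
    ((measurePreserving_prodAssoc _ _ _).comp
      ((measurePreserving_fin_append_split (m + 1) n (gaussianReal 0 v)).prod
        (MeasurePreserving.id _)))

theorem measurePreserving_gaussian_matrix {m n : ℕ} (v : ℝ≥0) (u : Fin n → ℝ) (i : Fin (m + 1)) :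
    MeasurePreserving
      (fun p : (Fin (m + 1) → Fin (m + 1 + n) → ℝ) × (Fin (m + 1) → ℝ) =>
        ((fun k j => p.1 k (Fin.castAdd n (i.succAbove j))),
          ((fun k => p.1 k (Fin.castAdd n i)),
            fun k => p.2 k - ∑ q, p.1 k (Fin.natAdd (m + 1) q) * u q)))
      ((Measure.pi fun _ => Measure.pi fun _ => gaussianReal 0 v).prod
        (Measure.pi fun _ => gaussianReal 0 v))
      ((Measure.pi fun _ => Measure.pi fun _ : Fin m => gaussianReal 0 v).prod
        ((Measure.pi fun _ => gaussianReal 0 v).prod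
          (Measure.pi fun _ => gaussianReal 0 ((1 + ∑ q, u q ^ 2).toNNReal * v)))) :=
  (measurePreserving_prodAssoc _ _ _).comp <|
    ((Measure.measurePreserving_swap.comp
      (measurePreserving_arrowProdEquivProdArrow _ _ (Fin (m + 1)) (fun _ => gaussianReal 0 v)
        (fun _ => Measure.pi fun _ : Fin m => gaussianReal 0 v))).prod
          (MeasurePreserving.id _)).comp <|
    (measurePreserving_arrowProdEquivProdArrow _ _ (Fin (m + 1))
      (fun _ => (gaussianReal 0 v).prod (Measure.pi fun _ : Fin m => gaussianReal 0 v))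
      (fun _ => gaussianReal 0 ((1 + ∑ q, u q ^ 2).toNNReal * v))).comp <|
    (measurePreserving_pi _ _ fun _ : Fin (m + 1) => measurePreserving_gaussian_row v u i).comp
      (measurePreserving_arrowProdEquivProdArrow _ _ (Fin (m + 1))
        (fun _ => Measure.pi fun _ : Fin (m + 1 + n) => gaussianReal 0 v)
        (fun _ => gaussianReal 0 v)).symm

theorem Matrix.inv_mulVec_apply_eq_div {K : Type*} [Field K] {m : ℕ}
    (B : Matrix (Fin (m + 1)) (Fin (m + 1)) K) (y : Fin (m + 1) → K) (i : Fin (m + 1)) :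
    (B⁻¹ *ᵥ y) i =
      (∑ k : Fin (m + 1), (-1) ^ (k + i : ℕ) * (B.submatrix k.succAbove i.succAbove).det * y k) /
        ∑ k : Fin (m + 1), (-1) ^ (k + i : ℕ) * (B.submatrix k.succAbove i.succAbove).det * B k i := by
  have hdet : B.det =
      ∑ k : Fin (m + 1), (-1) ^ (k + i : ℕ) * (B.submatrix k.succAbove i.succAbove).det * B k i := by
    rw [det_succ_column B i]
    exact Finset.sum_congr rfl fun k _ => by ring
  rw [← hdet, inv_def, Ring.inverse_eq_inv', smul_mulVec, Pi.smul_apply, smul_eq_mul,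
    div_eq_inv_mul]
  simp only [mulVec, dotProduct, adjugate_fin_succ_eq_det_submatrix]

theorem pi_gaussianReal_prod_map_sum_div_sum {ι : Type*} [Fintype ι] {v w : ℝ≥0} (hv : v ≠ 0)
    {β : ℝ} (hβ : 0 < β) (hw : (w : ℝ) = β ^ 2 * v) {c : ι → ℝ} (hc : c ≠ 0) :
    ((Measure.pi fun _ : ι => gaussianReal 0 v).prod
      (Measure.pi fun _ : ι => gaussianReal 0 w)).map
        (fun p => (∑ k, c k * p.2 k) / ∑ k, c k * p.1 k) =
      volume.withDensity fun ζ : ℝ => ENNReal.ofReal (β / (Real.pi * (β ^ 2 + ζ ^ 2))) := by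
  have hm : Measurable fun x : ι → ℝ => ∑ k, c k * x k := by fun_prop
  have hpos : 0 < ∑ k, c k ^ 2 := by
    obtain ⟨k, hk⟩ := Function.ne_iff.mp hc
    exact Finset.sum_pos' (fun _ _ => sq_nonneg _) ⟨k, Finset.mem_univ k, sq_pos_of_ne_zero hk⟩
  rw [← gaussianReal_prod_map_div (v := (∑ k, c k ^ 2).toNNReal * v)
    (w := (∑ k, c k ^ 2).toNNReal * w) (mul_ne_zero (by simpa using hpos) hv) hβ
    (by push_cast; rw [hw]; ring), ← map_sum_mul_pi_gaussianReal, ← map_sum_mul_pi_gaussianReal,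
    Measure.map_prod_map _ _ hm hm, Measure.map_map (by fun_prop) (by fun_prop)]
  rfl

/-- **Girko's corollary (Gaussian case).** If the entries of the `m × (m+n)` matrix
`A` and of `b ∈ ℝ^m` are i.i.d. `N(0, σ²)`, `A = (B, X)`, and `u ∈ ℝⁿ` is fixed with
`β = √(1 + ∑ u_p²)`, then each component `z_i` of `z = B⁻¹(b − Xu)` follows a Cauchy
distribution of width `β`, independently of `σ` and of `i`. -/
theorem girko_gaussian_component_cauchy (m n : ℕ) (hm : 1 ≤ m) (hn : 1 ≤ n)
    (σ : ℝ≥0) (hσ : 0 < σ)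
    (μ : Measure ((Fin m → Fin (m + n) → ℝ) × (Fin m → ℝ)))
    (hμ : μ = (Measure.pi fun _ : Fin m => Measure.pi fun _ : Fin (m + n) =>
        gaussianReal 0 (σ ^ 2)).prod
      (Measure.pi fun _ : Fin m => gaussianReal 0 (σ ^ 2)))
    (u : Fin n → ℝ) (β : ℝ) (hβ : β = Real.sqrt (1 + ∑ p, u p ^ 2)) (i : Fin m) :
    μ.map (fun p : (Fin m → Fin (m + n) → ℝ) × (Fin m → ℝ) =>
        (((Matrix.of p.1).submatrix id (Fin.castAdd n))⁻¹ *ᵥ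
          (p.2 - (Matrix.of p.1).submatrix id (Fin.natAdd m) *ᵥ u)) i)
      = volume.withDensity fun ζ : ℝ =>
          ENNReal.ofReal (β / (Real.pi * (β ^ 2 + ζ ^ 2))) := by
  obtain ⟨m, rfl⟩ := Nat.exists_eq_add_of_le' hm
  have hv : σ ^ 2 ≠ 0 := pow_ne_zero 2 hσ.ne'
  have hsum : 0 < 1 + ∑ p, u p ^ 2 :=
    add_pos_of_pos_of_nonneg one_pos (Finset.sum_nonneg fun p _ => sq_nonneg _)
  have hβ0 : 0 < β := hβ ▸ Real.sqrt_pos.mpr hsum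
  have hw : (((1 + ∑ p, u p ^ 2).toNNReal * σ ^ 2 : ℝ≥0) : ℝ) = β ^ 2 * (σ ^ 2 : ℝ≥0) := by
    rw [NNReal.coe_mul, Real.coe_toNNReal _ hsum.le, hβ, Real.sq_sqrt hsum.le]
  let C : (Fin (m + 1) → Fin m → ℝ) → Fin (m + 1) → ℝ := fun W k =>
    (-1) ^ (k + i : ℕ) * ((Matrix.of W).submatrix k.succAbove id).det
  let g : (Fin (m + 1) → Fin m → ℝ) × (Fin (m + 1) → ℝ) × (Fin (m + 1) → ℝ) → ℝ := fun p =>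
    (∑ k, C p.1 k * p.2.2 k) / ∑ k, C p.1 k * p.2.1 k
  have hC (k : Fin (m + 1)) : Measurable fun W => C W k := by
    refine Measurable.const_mul (Continuous.measurable ?_) _
    refine Continuous.matrix_det (continuous_pi fun k => continuous_pi fun l => ?_)
    simp only [submatrix_apply, of_apply]
    fun_prop
  have hg : Measurable g := by fun_prop
  have hT := measurePreserving_gaussian_matrix (σ ^ 2) u i
  have hcomp : (fun p : (Fin (m + 1) → Fin (m + 1 + n) → ℝ) × (Fin (m + 1) → ℝ) =>
      (((Matrix.of p.1).submatrix id (Fin.castAdd n))⁻¹ *ᵥ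
        (p.2 - (Matrix.of p.1).submatrix id (Fin.natAdd (m + 1)) *ᵥ u)) i) =
      g ∘ fun p => ((fun k j => p.1 k (Fin.castAdd n (i.succAbove j))),
        ((fun k => p.1 k (Fin.castAdd n i)),
          fun k => p.2 k - ∑ q, p.1 k (Fin.natAdd (m + 1) q) * u q)) :=
    funext fun p => Matrix.inv_mulVec_apply_eq_div _ _ i
  rw [hcomp, hμ, ← Measure.map_map hg hT.measurable, hT.map_eq]
  ext S hS
  rw [Measure.map_apply hg hS, Measure.prod_apply (hg hS)]
  refine (lintegral_congr_ae (g := fun _ => volume.withDensity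
    (fun ζ : ℝ => ENNReal.ofReal (β / (Real.pi * (β ^ 2 + ζ ^ 2)))) S) ?_).trans (by simp)
  filter_upwards [ae_det_submatrix_succ_ne_zero hv] with W hW
  have hCW : C W ≠ 0 := Function.ne_iff.mpr ⟨0, mul_ne_zero (by simp) (by simpa using hW)⟩
  rw [← pi_gaussianReal_prod_map_sum_div_sum hv hβ0 hw hCW, Measure.map_apply (by fun_prop) hS]
  rfl
end

section
/- Let m, n ≥ 1 be integers, q > 0 a real number, M a real m×n matrix, Σ a symmetric positive definite m×m real matrix, and Ω a symmetric positive definite n×n real matrix. Then the integral over all real m×n matrices Z of (det(1ₘ + Σ⁻¹(Z − M)Ω⁻¹(Z − M)ᵀ))^(−(m+n+q−1)/2) with respect to Lebesgue measure equals (det Σ)^{n/2} · (det Ω)^{m/2} · π^{mn/2} · ∏_{j=1}^{n} Γ((n+q−j)/2)/Γ((m+n+q−j)/2). -/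
open MeasureTheory Matrix
open scoped ENNReal Real

section Lintegral

theorem lintegral_ofReal_eq_of_integral_eq {α : Type*} [MeasurableSpace α] {μ : Measure α}
    {f : α → ℝ} {c : ℝ} (hf : 0 ≤ᵐ[μ] f) (hc : c ≠ 0) (h : ∫ x, f x ∂μ = c) :
    ∫⁻ x, ENNReal.ofReal (f x) ∂μ = ENNReal.ofReal c := by
  rw [← h, ofReal_integral_eq_lintegral_ofReal (.of_integral_ne_zero (h.trans_ne hc)) hf]

theorem lintegral_eq_abs_det_mul_lintegral_comp {E : Type*} [NormedAddCommGroup E]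
    [NormedSpace ℝ E] [FiniteDimensional ℝ E] [MeasurableSpace E] [BorelSpace E]
    (μ : Measure E) [μ.IsAddHaarMeasure] (f : E →ₗ[ℝ] E) (hf : LinearMap.det f ≠ 0)
    (g : E → ℝ≥0∞) :
    ∫⁻ x, g x ∂μ = ENNReal.ofReal |LinearMap.det f| * ∫⁻ x, g (f x) ∂μ := by
  let e : E ≃ᵐ E :=
    (LinearMap.equivOfDetNeZero f hf).toContinuousLinearEquiv.toHomeomorph.toMeasurableEquiv
  have he : ∀ x, e x = f x := fun _ => rfl
  have hmap : ∫⁻ x, g (f x) ∂μ = ∫⁻ x, g x ∂(μ.map f) := (lintegral_map_equiv g e).symm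
  rw [hmap, Measure.map_linearMap_addHaar_eq_smul_addHaar μ hf, lintegral_smul_measure,
    smul_eq_mul, ← mul_assoc, ← ENNReal.ofReal_mul (abs_nonneg _), abs_inv,
    mul_inv_cancel₀ (abs_ne_zero.mpr hf), ENNReal.ofReal_one, one_mul]

theorem lintegral_exp_neg_mul_dotProduct_self {ι : Type*} [Fintype ι] {t : ℝ} (ht : 0 < t) :
    ∫⁻ x : ι → ℝ, ENNReal.ofReal (Real.exp (-(t * (x ⬝ᵥ x)))) =
      ENNReal.ofReal ((π / t) ^ ((Fintype.card ι : ℝ) / 2)) := by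
  refine lintegral_ofReal_eq_of_integral_eq (.of_forall fun _ => (Real.exp_pos _).le)
    (by positivity) ?_
  have h : ∀ x : ι → ℝ, Real.exp (-(t * (x ⬝ᵥ x))) = ∏ i, Real.exp (-t * x i ^ 2) := by
    intro x
    rw [← Real.exp_sum, dotProduct, Finset.mul_sum, ← Finset.sum_neg_distrib]
    congr 1
    exact Finset.sum_congr rfl fun i _ => by ring
  simp_rw [h]
  rw [integral_fintype_prod_volume_eq_pow (fun y : ℝ => Real.exp (-t * y ^ 2)),
    integral_gaussian, Real.sqrt_eq_rpow, ← Real.rpow_natCast, ← Real.rpow_mul (by positivity)]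
  congr 1
  ring

theorem lintegral_Ioi_rpow_mul_exp_neg_mul {a r : ℝ} (ha : 0 < a) (hr : 0 < r) :
    ∫⁻ t in Set.Ioi (0 : ℝ), ENNReal.ofReal (t ^ (a - 1) * Real.exp (-(r * t))) =
      ENNReal.ofReal ((1 / r) ^ a * Real.Gamma a) := by
  refine lintegral_ofReal_eq_of_integral_eq ?_ ?_ (Real.integral_rpow_mul_exp_neg_mul_Ioi ha hr)
  · filter_upwards [ae_restrict_mem measurableSet_Ioi] with t ht
    have : (0 : ℝ) < t := ht
    simp only [Pi.zero_apply]
    positivity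
  · have := Real.Gamma_pos_of_pos ha
    positivity

theorem lintegral_one_add_dotProduct_self_rpow {ι : Type*} [Fintype ι] {a : ℝ}
    (ha : (Fintype.card ι : ℝ) / 2 < a) :
    ∫⁻ x : ι → ℝ, ENNReal.ofReal ((1 + x ⬝ᵥ x) ^ (-a)) =
      ENNReal.ofReal (π ^ ((Fintype.card ι : ℝ) / 2) *
        Real.Gamma (a - (Fintype.card ι : ℝ) / 2) / Real.Gamma a) := by
  set k : ℝ := (Fintype.card ι : ℝ) / 2 with hk
  have hk0 : 0 ≤ k := by positivity
  have ha0 : 0 < a := hk0.trans_lt ha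
  have hG := Real.Gamma_pos_of_pos ha0
  have hG' := Real.Gamma_pos_of_pos (sub_pos.mpr ha)
  have hx : ∀ x : ι → ℝ, 0 < 1 + x ⬝ᵥ x := fun x => by
    have : 0 ≤ x ⬝ᵥ x := Finset.sum_nonneg fun i _ => mul_self_nonneg (x i)
    linarith
  have hdot : Continuous fun x : ι → ℝ => x ⬝ᵥ x := by
    unfold dotProduct
    fun_prop
  have key : ENNReal.ofReal (Real.Gamma a) *
      ∫⁻ x : ι → ℝ, ENNReal.ofReal ((1 + x ⬝ᵥ x) ^ (-a)) =
      ENNReal.ofReal (π ^ k * Real.Gamma (a - k)) := by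
    calc
      _ = ∫⁻ x : ι → ℝ, ∫⁻ t in Set.Ioi (0 : ℝ),
          ENNReal.ofReal (t ^ (a - 1) * Real.exp (-((1 + x ⬝ᵥ x) * t))) := by
        rw [← lintegral_const_mul' _ _ ENNReal.ofReal_ne_top]
        refine lintegral_congr fun x => ?_
        rw [lintegral_Ioi_rpow_mul_exp_neg_mul ha0 (hx x), ← ENNReal.ofReal_mul hG.le,
          one_div, Real.inv_rpow (hx x).le, Real.rpow_neg (hx x).le, mul_comm]
      _ = ∫⁻ t in Set.Ioi (0 : ℝ), ∫⁻ x : ι → ℝ,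
          ENNReal.ofReal (t ^ (a - 1) * Real.exp (-((1 + x ⬝ᵥ x) * t))) := by
        refine lintegral_lintegral_swap (Measurable.aemeasurable ?_)
        refine Measurable.ennreal_ofReal ?_
        have h2 : Measurable fun z : (ι → ℝ) × ℝ => Real.exp (-((1 + z.1 ⬝ᵥ z.1) * z.2)) :=
          (Real.continuous_exp.comp (((continuous_const.add
            (hdot.comp continuous_fst)).mul continuous_snd).neg)).measurable
        exact (measurable_snd.pow_const _).mul h2
      _ = ∫⁻ t in Set.Ioi (0 : ℝ),
          ENNReal.ofReal (π ^ k) * ENNReal.ofReal (t ^ (a - k - 1) * Real.exp (-(1 * t))) := by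
        refine setLIntegral_congr_fun measurableSet_Ioi fun t (ht : 0 < t) => ?_
        have h : ∀ x : ι → ℝ, ENNReal.ofReal (t ^ (a - 1) * Real.exp (-((1 + x ⬝ᵥ x) * t))) =
            ENNReal.ofReal (t ^ (a - 1) * Real.exp (-t)) *
              ENNReal.ofReal (Real.exp (-(t * (x ⬝ᵥ x)))) := by
          intro x
          rw [← ENNReal.ofReal_mul (by positivity), mul_assoc, ← Real.exp_add]
          congr 3
          ring
        simp_rw [h]
        rw [lintegral_const_mul' _ _ ENNReal.ofReal_ne_top,
          lintegral_exp_neg_mul_dotProduct_self ht, ← ENNReal.ofReal_mul (by positivity),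
          ← ENNReal.ofReal_mul (by positivity), Real.div_rpow Real.pi_pos.le ht.le, ← hk,
          show a - k - 1 = a - 1 - k by ring, Real.rpow_sub ht (a - 1) k, one_mul]
        congr 1
        ring
      _ = _ := by
        rw [lintegral_const_mul' _ _ ENNReal.ofReal_ne_top,
          lintegral_Ioi_rpow_mul_exp_neg_mul (sub_pos.mpr ha) one_pos,
          ← ENNReal.ofReal_mul (by positivity)]
        simp
  rw [ENNReal.ofReal_div_of_pos hG, ← key, mul_comm,
    ENNReal.mul_div_cancel_right (ENNReal.ofReal_pos.mpr hG).ne' ENNReal.ofReal_ne_top]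

end Lintegral

section MatrixIntegral

open scoped MatrixOrder Matrix.Norms.L2Operator in
theorem Matrix.PosDef.exists_eq_transpose_mul_self {ι : Type*} [Fintype ι] [DecidableEq ι]
    {B : Matrix ι ι ℝ} (hB : B.PosDef) : ∃ P : Matrix ι ι ℝ, P.det ≠ 0 ∧ B = Pᵀ * P := by
  obtain ⟨P, hP⟩ := CStarAlgebra.nonneg_iff_eq_star_mul_self.mp hB.posSemidef.nonneg
  rw [star_eq_conjTranspose, conjTranspose_eq_transpose_of_trivial] at hP
  refine ⟨P, fun h => hB.det_pos.ne' ?_, hP⟩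
  rw [hP, det_mul, h, mul_zero]

theorem Matrix.posDef_one_add_transpose_mul_self {κ ι : Type*} [Fintype κ] [Fintype ι]
    [DecidableEq ι] (Y : Matrix κ ι ℝ) : (1 + Yᵀ * Y).PosDef := by
  have h := posSemidef_conjTranspose_mul_self Y
  rw [conjTranspose_eq_transpose_of_trivial] at h
  exact PosDef.one.add_posSemidef h

theorem lintegral_det_add_vecMulVec_self_rpow {ι : Type*} [Fintype ι] [DecidableEq ι]
    {B : Matrix ι ι ℝ} (hB : B.PosDef) {a : ℝ} (ha : (Fintype.card ι : ℝ) / 2 < a) :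
    ∫⁻ y : ι → ℝ, ENNReal.ofReal ((B + vecMulVec y y).det ^ (-a)) =
      ENNReal.ofReal (B.det ^ (-(a - 1 / 2))) *
        ENNReal.ofReal (π ^ ((Fintype.card ι : ℝ) / 2) *
          Real.Gamma (a - (Fintype.card ι : ℝ) / 2) / Real.Gamma a) := by
  obtain ⟨P, hP, rfl⟩ := hB.exists_eq_transpose_mul_self
  have hdet : ∀ x : ι → ℝ, (Pᵀ * P + vecMulVec (Pᵀ *ᵥ x) (Pᵀ *ᵥ x)).det =
      (Pᵀ * P).det * (1 + x ⬝ᵥ x) := by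
    intro x
    have : Pᵀ * P + vecMulVec (Pᵀ *ᵥ x) (Pᵀ *ᵥ x) = Pᵀ * (1 + vecMulVec x x) * P := by
      rw [Matrix.mul_add, Matrix.add_mul, Matrix.mul_one, Matrix.mul_vecMulVec,
        Matrix.vecMulVec_mul, Matrix.mulVec_transpose]
    rw [this, det_mul, det_mul, det_mul, vecMulVec_eq Unit,
      det_one_add_replicateCol_mul_replicateRow]
    ring
  have hf : LinearMap.det (Matrix.toLin' Pᵀ) ≠ 0 := by
    rwa [LinearMap.det_toLin', det_transpose]
  have hB0 := hB.det_pos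
  rw [lintegral_eq_abs_det_mul_lintegral_comp volume (Matrix.toLin' Pᵀ) hf]
  simp only [Matrix.toLin'_apply, hdet]
  have hx : ∀ x : ι → ℝ, 0 ≤ 1 + x ⬝ᵥ x := fun x => by
    have : 0 ≤ x ⬝ᵥ x := Finset.sum_nonneg fun i _ => mul_self_nonneg (x i)
    linarith
  have h : ∀ x : ι → ℝ, ENNReal.ofReal (((Pᵀ * P).det * (1 + x ⬝ᵥ x)) ^ (-a)) =
      ENNReal.ofReal ((Pᵀ * P).det ^ (-a)) * ENNReal.ofReal ((1 + x ⬝ᵥ x) ^ (-a)) := by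
    intro x
    rw [Real.mul_rpow hB0.le (hx x), ENNReal.ofReal_mul (by positivity)]
  simp_rw [h]
  rw [lintegral_const_mul' _ _ ENNReal.ofReal_ne_top, lintegral_one_add_dotProduct_self_rpow ha,
    ← mul_assoc, ← ENNReal.ofReal_mul (abs_nonneg _), LinearMap.det_toLin', det_transpose]
  congr 2
  have hs : |P.det| = (Pᵀ * P).det ^ (1 / 2 : ℝ) := by
    rw [det_mul, det_transpose, ← Real.sqrt_eq_rpow, Real.sqrt_mul_self_eq_abs]
  rw [hs, ← Real.rpow_add hB0]
  congr 1
  ring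

theorem measurable_det_one_add_transpose_mul_self_rpow (m n : ℕ) (a : ℝ) :
    Measurable fun Y : Fin m → Fin n → ℝ =>
      ENNReal.ofReal ((1 + (Matrix.of Y)ᵀ * Matrix.of Y).det ^ (-a)) := by
  refine Measurable.ennreal_ofReal (Measurable.pow_const (Continuous.measurable ?_) _)
  have h : Continuous fun Y : Fin m → Fin n → ℝ => Matrix.of Y := continuous_id
  exact (continuous_const.add (h.matrix_transpose.matrix_mul h)).matrix_det

theorem lintegral_det_one_add_transpose_mul_self_rpow (m n : ℕ) (a : ℝ)
    (ha : (m + n - 1 : ℝ) / 2 < a) :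
    ∫⁻ Y : Fin m → Fin n → ℝ,
        ENNReal.ofReal ((1 + (Matrix.of Y)ᵀ * Matrix.of Y).det ^ (-a)) =
      ENNReal.ofReal (∏ i ∈ Finset.range m, π ^ ((n : ℝ) / 2) *
        Real.Gamma (a - i / 2 - n / 2) / Real.Gamma (a - i / 2)) := by
  induction m generalizing a with
  | zero => simp [volume_pi]
  | succ m ih =>
    have hmeas := measurable_det_one_add_transpose_mul_self_rpow (m + 1) n a
    let e := MeasurableEquiv.piFinSuccAbove (fun _ : Fin (m + 1) => Fin n → ℝ) 0
    have he : MeasurePreserving e.symm :=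
      (volume_preserving_piFinSuccAbove (fun _ : Fin (m + 1) => Fin n → ℝ) 0).symm
    have hsplit : ∀ (y : Fin n → ℝ) (Y : Fin m → Fin n → ℝ),
        1 + (Matrix.of (e.symm (y, Y)))ᵀ * Matrix.of (e.symm (y, Y)) =
          (1 + (Matrix.of Y)ᵀ * Matrix.of Y) + vecMulVec y y := by
      intro y Y
      ext i j
      simp [e, Matrix.mul_apply, Fin.sum_univ_succ, vecMulVec_apply, Fin.insertNthEquiv]
      ring
    rw [← he.lintegral_comp hmeas, Measure.volume_eq_prod,
      lintegral_prod_symm _ (by exact (hmeas.comp he.measurable).aemeasurable)]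
    push_cast at ha
    have hm0 : (0 : ℝ) ≤ m := m.cast_nonneg
    have hn0 : (0 : ℝ) ≤ n := n.cast_nonneg
    have hna : (n : ℝ) / 2 < a := by linarith
    have hcard : (Fintype.card (Fin n) : ℝ) / 2 < a := by simpa using hna
    simp_rw [hsplit, lintegral_det_add_vecMulVec_self_rpow
      (Matrix.posDef_one_add_transpose_mul_self _) hcard]
    rw [lintegral_mul_const' _ _ ENNReal.ofReal_ne_top, ih (a - 1 / 2) (by linarith),
      Fintype.card_fin]
    have hG := Real.Gamma_pos_of_pos (sub_pos.mpr hna)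
    have hG' := Real.Gamma_pos_of_pos (show 0 < a by linarith)
    rw [← ENNReal.ofReal_mul' (by positivity), Finset.prod_range_succ']
    congr 2
    · refine Finset.prod_congr rfl fun i _ => ?_
      rw [show a - ((i + 1 : ℕ) : ℝ) / 2 = a - 1 / 2 - i / 2 by push_cast; ring]
    · simp

theorem lintegral_eq_abs_det_pow_mul_lintegral_mul_mul (m n : ℕ)
    (P : Matrix (Fin m) (Fin m) ℝ) (Q : Matrix (Fin n) (Fin n) ℝ) (hP : P.det ≠ 0)
    (hQ : Q.det ≠ 0) (g : Matrix (Fin m) (Fin n) ℝ → ℝ≥0∞) :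
    ∫⁻ Z : Fin m → Fin n → ℝ, g (Matrix.of Z) =
      ENNReal.ofReal (|P.det| ^ n * |Q.det| ^ m) *
        ∫⁻ Z : Fin m → Fin n → ℝ, g (P * Matrix.of Z * Q) := by
  let R : (Fin m → Fin n → ℝ) →ₗ[ℝ] (Fin m → Fin n → ℝ) :=
    LinearMap.pi fun i => (Matrix.toLin' Qᵀ).comp (LinearMap.proj i)
  let L' : (Fin n → Fin m → ℝ) →ₗ[ℝ] (Fin n → Fin m → ℝ) :=
    LinearMap.pi fun i => (Matrix.toLin' P).comp (LinearMap.proj i)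
  let τ : (Fin n → Fin m → ℝ) ≃ₗ[ℝ] (Fin m → Fin n → ℝ) :=
    Matrix.transposeLinearEquiv (Fin n) (Fin m) ℝ ℝ
  let L : (Fin m → Fin n → ℝ) →ₗ[ℝ] (Fin m → Fin n → ℝ) := τ ∘ₗ L' ∘ₗ τ.symm
  have hRdet : LinearMap.det R = Q.det ^ m := by
    simp [R, LinearMap.det_pi, LinearMap.det_toLin']
  have hLdet : LinearMap.det L = P.det ^ n := by
    simp only [L, LinearMap.det_conj]
    simp [L', LinearMap.det_pi, LinearMap.det_toLin']
  have hR : ∀ Z, Matrix.of (R Z) = Matrix.of Z * Q := by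
    intro Z
    ext i j
    simp [R, Matrix.mulVec, dotProduct, Matrix.mul_apply, mul_comm]
  have hL : ∀ Z, Matrix.of (L Z) = P * Matrix.of Z := by
    intro Z
    ext i j
    change (P *ᵥ fun k => Z k j) i = _
    simp [Matrix.mulVec, dotProduct, Matrix.mul_apply]
  rw [lintegral_eq_abs_det_mul_lintegral_comp volume (L ∘ₗ R)
    (by rw [LinearMap.det_comp, hRdet, hLdet]; positivity)]
  simp only [LinearMap.comp_apply, hL, hR, LinearMap.det_comp, hRdet, hLdet, abs_mul, abs_pow,
    Matrix.mul_assoc]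

theorem Finset.prod_range_div_add_comm (g : ℕ → ℝ) (hg : ∀ k, g k ≠ 0) (m n : ℕ) :
    ∏ i ∈ Finset.range m, g i / g (n + i) = ∏ j ∈ Finset.range n, g j / g (m + j) := by
  have h₁ := Finset.prod_range_add g n m
  have h₂ := Finset.prod_range_add g m n
  rw [Finset.prod_div_distrib, Finset.prod_div_distrib,
    div_eq_div_iff (Finset.prod_ne_zero_iff.mpr fun _ _ => hg _)
      (Finset.prod_ne_zero_iff.mpr fun _ _ => hg _), ← h₂, add_comm m n, h₁]

end MatrixIntegral

/-- Normalization of the matrix variate `t`-distribution `T_{n,m}(q, M, Σ, Ω)`: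
`∫ det(1ₘ + Σ⁻¹(Z−M)Ω⁻¹(Z−M)ᵀ)^(−(m+n+q−1)/2) dZ
  = (det Σ)^{n/2} (det Ω)^{m/2} π^{mn/2} ∏_{j=1}^n Γ((n+q−j)/2)/Γ((m+n+q−j)/2)`. -/
theorem matrix_variate_t_normalization (m n : ℕ) (hm : 1 ≤ m) (hn : 1 ≤ n)
    (q : ℝ) (hq : 0 < q) (M : Matrix (Fin m) (Fin n) ℝ)
    (S : Matrix (Fin m) (Fin m) ℝ) (hS : S.PosDef)
    (W : Matrix (Fin n) (Fin n) ℝ) (hW : W.PosDef) :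
    (∫⁻ Z : Fin m → Fin n → ℝ,
        ENNReal.ofReal
          (Matrix.det
              (1 + S⁻¹ * (Matrix.of Z - M) * W⁻¹ * (Matrix.of Z - M)ᵀ) ^
            (-((m : ℝ) + n + q - 1) / 2)))
      = ENNReal.ofReal
          (S.det ^ ((n : ℝ) / 2) * W.det ^ ((m : ℝ) / 2) *
            Real.pi ^ ((m * n : ℝ) / 2) *
            ∏ j ∈ Finset.range n,
              Real.Gamma ((n + q - (j + 1) : ℝ) / 2) /
                Real.Gamma ((m + n + q - (j + 1) : ℝ) / 2)) := by
  obtain ⟨P, hP, rfl⟩ := hS.exists_eq_transpose_mul_self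
  obtain ⟨Q, hQ, rfl⟩ := hW.exists_eq_transpose_mul_self
  have hPu : IsUnit P.det := hP.isUnit
  have hQu : IsUnit Q.det := hQ.isUnit
  have hPt : IsUnit Pᵀ.det := by rwa [det_transpose]
  have hQt : IsUnit Qᵀ.det := by rwa [det_transpose]
  have hdet : ∀ Y : Matrix (Fin m) (Fin n) ℝ,
      (1 + (Pᵀ * P)⁻¹ * (Pᵀ * Y * Q) * (Qᵀ * Q)⁻¹ * (Pᵀ * Y * Q)ᵀ).det = (1 + Yᵀ * Y).det := by
    intro Y
    have h : (Pᵀ * P)⁻¹ * (Pᵀ * Y * Q) * (Qᵀ * Q)⁻¹ * (Pᵀ * Y * Q)ᵀ = P⁻¹ * (Y * (Yᵀ * P)) := by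
      simp only [Matrix.mul_inv_rev, Matrix.transpose_mul, Matrix.transpose_transpose,
        Matrix.mul_assoc, Matrix.nonsing_inv_mul_cancel_left _ _ hPt,
        Matrix.mul_nonsing_inv_cancel_left _ _ hQu, Matrix.nonsing_inv_mul_cancel_left _ _ hQt]
    rw [h, det_one_add_mul_comm, Matrix.mul_assoc, Matrix.mul_assoc, Matrix.mul_nonsing_inv _ hPu,
      Matrix.mul_one, det_one_add_mul_comm]
  have hshift := lintegral_sub_right_eq_self (μ := (volume : Measure (Fin m → Fin n → ℝ)))
    (fun Z => ENNReal.ofReal ((1 + (Pᵀ * P)⁻¹ * Matrix.of Z * (Qᵀ * Q)⁻¹ * (Matrix.of Z)ᵀ).det ^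
      (-((m : ℝ) + n + q - 1) / 2))) M
  refine hshift.trans ?_
  refine (lintegral_eq_abs_det_pow_mul_lintegral_mul_mul m n Pᵀ Q hPt.ne_zero hQ
    (fun Z => ENNReal.ofReal ((1 + (Pᵀ * P)⁻¹ * Z * (Qᵀ * Q)⁻¹ * Zᵀ).det ^
      (-((m : ℝ) + n + q - 1) / 2)))).trans ?_
  simp only [hdet, neg_div]
  rw [lintegral_det_one_add_transpose_mul_self_rpow m n _ (by linarith),
    ← ENNReal.ofReal_mul (by positivity)]
  congr 1
  have habs : ∀ (k l : ℕ) (A : Matrix (Fin l) (Fin l) ℝ),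
      (Aᵀ * A).det ^ ((k : ℝ) / 2) = |A.det| ^ k := by
    intro k l A
    rw [det_mul, det_transpose, ← abs_mul_abs_self, ← pow_two, ← Real.rpow_natCast_mul
      (abs_nonneg _), ← Real.rpow_natCast]
    congr 1
    push_cast
    ring
  have hpi : (π ^ ((n : ℝ) / 2)) ^ m = π ^ ((m * n : ℝ) / 2) := by
    rw [← Real.rpow_mul_natCast Real.pi_pos.le]
    congr 1
    ring
  have hg : ∀ k : ℕ, Real.Gamma ((q + k) / 2) ≠ 0 := fun k =>
    (Real.Gamma_pos_of_pos (by positivity)).ne'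
  have h₁ : ∏ i ∈ Finset.range m, Real.Gamma ((m + n + q - 1 : ℝ) / 2 - i / 2 - n / 2) /
      Real.Gamma ((m + n + q - 1 : ℝ) / 2 - i / 2) =
      ∏ i ∈ Finset.range m, Real.Gamma ((q + (i : ℕ)) / 2) / Real.Gamma ((q + (n + i : ℕ)) / 2) := by
    rw [← Finset.prod_range_reflect]
    refine Finset.prod_congr rfl fun i hi => ?_
    rw [Finset.mem_range] at hi
    rw [Nat.sub_sub, Nat.cast_sub (by omega)]
    push_cast
    congr 2 <;> ring
  have h₂ : ∏ j ∈ Finset.range n, Real.Gamma ((n + q - (j + 1) : ℝ) / 2) /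
      Real.Gamma ((m + n + q - (j + 1) : ℝ) / 2) =
      ∏ j ∈ Finset.range n, Real.Gamma ((q + (j : ℕ)) / 2) / Real.Gamma ((q + (m + j : ℕ)) / 2) := by
    rw [← Finset.prod_range_reflect]
    refine Finset.prod_congr rfl fun j hj => ?_
    rw [Finset.mem_range] at hj
    rw [Nat.sub_sub, Nat.cast_sub (by omega)]
    push_cast
    congr 2 <;> ring
  simp only [mul_div_assoc (π ^ ((n : ℝ) / 2)), Finset.prod_mul_distrib, Finset.prod_const,
    Finset.card_range]
  rw [h₁, h₂, Finset.prod_range_div_add_comm (fun k => Real.Gamma ((q + k) / 2)) hg, habs, habs,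
    hpi, det_transpose]
  ring
end
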